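/- arXiv:2006.00307 — 3 statements merged into one kernel-verified Lean document; each statement's English description precedes it below -/
import Mathlib

section
/- For distinct real values s₁ ≠ s₂ with s₁, s₂ ≥ 0, the subspaces M_{φ_{s₁}} H²(ℝ) and M_{φ_{s₂}} H²(ℝ) of L²(ℝ) intersect trivially, i.e. their intersection is {0}. -/
open MeasureTheory Complex Filter Set

noncomputable section

abbrev L2 : Type := Lp ℂ 2 (volume : Measure ℝ)

/-- `F` is the Fourier–Plancherel transform: a unitary on `L²(ℝ)` given by the usual
integral formula on `L¹ ∩ L²`. -/
def IsFourierPlancherel (F : L2 →L[ℂ] L2) : Prop :=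
  Isometry F ∧ Function.Surjective F ∧
  ∀ f : L2, Integrable (⇑f) volume →
    ⇑(F f) =ᵐ[volume] fun x : ℝ =>
      ((Real.sqrt (2 * Real.pi) : ℂ))⁻¹ * ∫ t : ℝ, f t * Complex.exp (-(Complex.I * t * x))

/-- The Hardy space `H²(ℝ)`: elements of `L²(ℝ)` whose Fourier transform is supported
in `[0, ∞)`. -/
def H2 (F : L2 →L[ℂ] L2) : Set L2 :=
  {f : L2 | ∀ᵐ x : ℝ ∂volume, x < 0 → (F f) x = 0}

open scoped Topology ComplexConjugate InnerProductSpace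

lemma FF (F : L2 →L[ℂ] L2) (hF : IsFourierPlancherel F) (q : ℝ → ℂ) (h2 : MemLp q 2 volume)
    (h1 : Integrable q volume) :
    ⇑(F (h2.toLp q)) =ᵐ[volume] fun x : ℝ =>
      ((Real.sqrt (2 * Real.pi) : ℂ))⁻¹ * ∫ t : ℝ, q t * Complex.exp (-(Complex.I * t * x)) := by
  have hq := h2.coeFn_toLp
  have := hF.2.2 (h2.toLp q) (h1.congr hq.symm)
  refine this.trans (Filter.Eventually.of_forall fun x => ?_)
  dsimp only
  congr 1
  apply integral_congr_ae
  filter_upwards [hq] with t ht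
  rw [ht]

lemma Finj (F : L2 →L[ℂ] L2) (hF : IsFourierPlancherel F) {g : L2} (h : F g = 0) : g = 0 :=
  hF.1.injective (by rw [h, map_zero])

lemma q_zero (F : L2 →L[ℂ] L2) (hF : IsFourierPlancherel F) (q : ℝ → ℂ) (h2 : MemLp q 2 volume)
    (h1 : Integrable q volume)
    (hz : ∀ ω : ℝ, ∫ t : ℝ, q t * Complex.exp (-(Complex.I * t * ω)) = 0) : q =ᵐ[volume] 0 := by
  have h := FF F hF q h2 h1
  have h0 : F (h2.toLp q) = 0 := by
    apply Lp.ext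
    filter_upwards [h, Lp.coeFn_zero ℂ 2 (volume : Measure ℝ)] with x hx hx0
    rw [hx, hx0, hz x]
    simp
  have := Finj F hF h0
  have h3 := h2.coeFn_toLp
  rw [this] at h3
  exact h3.symm.trans (Lp.coeFn_zero ℂ 2 volume)

lemma Finner (F : L2 →L[ℂ] L2) (hF : IsFourierPlancherel F) (f g : L2) :
    ⟪F f, F g⟫_ℂ = ⟪f, g⟫_ℂ := by
  let Fi : L2 →ₗᵢ[ℂ] L2 := ⟨F.toLinearMap, fun x => by
    have := hF.1.norm_map_of_map_zero (map_zero F) x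
    exact this⟩
  exact Fi.inner_map_map f g

/-- weighted dilation operator -/
lemma exists_dil (a : ℝ) (ha : a ≠ 0) (m : ℝ → ℂ) (hm : Continuous m) (hb : ∀ x, ‖m x‖ ≤ 1) :
    ∃ W : L2 →L[ℂ] L2, ∀ h : L2, ⇑(W h) =ᵐ[volume] fun x => m x * h (a * x) := by
  have hq : Measure.QuasiMeasurePreserving (fun x : ℝ => a * x) volume volume := by
    refine ⟨by fun_prop, ?_⟩
    rw [Real.map_volume_mul_left ha]
    exact Measure.smul_absolutelyContinuous
  have hn : ∀ h : L2, eLpNorm (fun x => m x * h (a * x)) 2 volume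
      ≤ (ENNReal.ofReal |a⁻¹|) ^ (1 / 2 : ENNReal).toReal * eLpNorm h 2 volume := by
    intro h
    calc eLpNorm (fun x => m x * h (a * x)) 2 volume
        ≤ eLpNorm (⇑h ∘ (fun x => a * x)) 2 volume := by
          apply eLpNorm_mono
          intro x
          rw [norm_mul]
          exact mul_le_of_le_one_left (norm_nonneg _) (hb x)
      _ = eLpNorm h 2 (Measure.map (fun x => a * x) volume) := by
          rw [eLpNorm_map_measure _ (by fun_prop)]
          rw [Real.map_volume_mul_left ha]
          exact (Lp.aestronglyMeasurable h).smul_measure _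
      _ = _ := by
          rw [Real.map_volume_mul_left ha, eLpNorm_smul_measure_of_ne_top (by simp), smul_eq_mul]
  have hm2 : ∀ h : L2, MemLp (fun x => m x * h (a * x)) 2 volume := fun h =>
    ⟨hm.aestronglyMeasurable.mul ((Lp.aestronglyMeasurable h).comp_quasiMeasurePreserving hq),
      (hn h).trans_lt (ENNReal.mul_lt_top (ENNReal.rpow_lt_top_of_nonneg (by simp) (by simp))
        (Lp.eLpNorm_lt_top h))⟩
  let T : L2 →ₗ[ℂ] L2 :=
    { toFun := fun h => (hm2 h).toLp _
      map_add' := fun f g => by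
        rw [← MemLp.toLp_add]
        apply MemLp.toLp_congr
        filter_upwards [hq.ae (Lp.coeFn_add f g)] with x hx
        simp only [Pi.add_apply] at hx ⊢
        rw [hx]; ring
      map_smul' := fun c f => by
        rw [RingHom.id_apply, ← MemLp.toLp_const_smul]
        apply MemLp.toLp_congr
        filter_upwards [hq.ae (Lp.coeFn_smul c f)] with x hx
        simp only [Pi.smul_apply, smul_eq_mul] at hx ⊢
        rw [hx]; ring }
  refine ⟨T.mkContinuous ((ENNReal.ofReal |a⁻¹|) ^ (1 / 2 : ENNReal).toReal).toReal ?_, ?_⟩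
  · intro h
    change ‖(hm2 h).toLp _‖ ≤ _
    rw [Lp.norm_toLp, Lp.norm_def, ← ENNReal.toReal_mul]
    exact ENNReal.toReal_mono (ENNReal.mul_lt_top (ENNReal.rpow_lt_top_of_nonneg (by simp) (by simp))
        (Lp.eLpNorm_lt_top h)).ne (hn h)
  · intro h
    exact (hm2 h).coeFn_toLp

/-- Cauchy transform -/
lemma slit_bound (w : ℂ) (hw : w ∈ slitPlane) : ∃ c > 0, ∀ x : ℝ, 0 ≤ x → c * (1 + x) ≤ ‖(x : ℂ) + w‖ := by
  rcases hw with h | h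
  · refine ⟨min 1 w.re, by positivity, fun x hx => ?_⟩
    have h1 := (Complex.re_le_norm ((x : ℂ) + w))
    simp only [add_re, ofReal_re] at h1
    have := min_le_left 1 w.re
    have := min_le_right 1 w.re
    nlinarith
  · have hd : 0 < |w.im| := abs_pos.2 h
    set d := |w.im|
    have hp : 0 < 1 + ‖w‖ + d := by positivity
    refine ⟨d / (1 + ‖w‖ + d), by positivity, fun x hx => ?_⟩
    have h1 : d ≤ ‖(x : ℂ) + w‖ := by
      have := Complex.abs_im_le_norm ((x : ℂ) + w)
      simpa using this
    have h2 : x - ‖w‖ ≤ ‖(x : ℂ) + w‖ := by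
      have := norm_sub_le ((x : ℂ) + w) w
      simp only [add_sub_cancel_right, norm_real, Real.norm_eq_abs, abs_of_nonneg hx] at this
      linarith
    rw [div_mul_eq_mul_div, div_le_iff₀ hp]
    nlinarith [norm_nonneg w]

lemma inv_memLp : MemLp (fun x : ℝ => ((1 + x : ℝ) : ℝ)⁻¹) 2 (volume.restrict (Ioi 0)) := by
  rw [memLp_two_iff_integrable_sq_norm (by fun_prop)]
  have h := integrable_inv_one_add_sq.restrict (s := Ioi 0)
  refine h.mono' (by fun_prop) ?_
  filter_upwards [ae_restrict_mem measurableSet_Ioi] with x hx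
  have hx : (0:ℝ) < x := hx
  rw [norm_pow, norm_norm, norm_inv, inv_pow, Real.norm_of_nonneg (by linarith)]
  gcongr
  nlinarith

lemma cauchy_diff (v : ℝ → ℂ) (hv : MemLp v 2 (volume.restrict (Ioi 0))) (w : ℂ)
    (hw : w ∈ slitPlane) :
    DifferentiableAt ℂ (fun w : ℂ => ∫ x in Ioi (0:ℝ), v x * ((x : ℂ) + w)⁻¹) w := by
  obtain ⟨c, hc, hcb⟩ := slit_bound w hw
  have hvi : Integrable (fun x : ℝ => ‖v x‖ * (1 + x)⁻¹) (volume.restrict (Ioi 0)) :=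
    hv.norm.integrable_mul inv_memLp
  have hball : ∀ w' ∈ Metric.ball w (c/2), ∀ x : ℝ, 0 ≤ x → c / 2 * (1 + x) ≤ ‖(x : ℂ) + w'‖ := by
    intro w' hw' x hx
    have h1 := hcb x hx
    have h2 : ‖w' - w‖ < c / 2 := by simpa [dist_eq_norm] using hw'
    have h3 := norm_sub_le ((x:ℂ) + w') (w' - w)
    have h4 : (x:ℂ) + w' - (w' - w) = x + w := by ring
    rw [h4] at h3
    nlinarith
  refine (hasDerivAt_integral_of_dominated_loc_of_deriv_le
    (F' := fun w' x => v x * (-1 / ((x : ℂ) + w') ^ 2))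
    (bound := fun x => (c/2)⁻¹ ^ 2 * (‖v x‖ * (1 + x)⁻¹))
    (Metric.ball_mem_nhds w (half_pos hc)) ?_ ?_ ?_ ?_ ?_ ?_).2.differentiableAt
  · exact Filter.Eventually.of_forall fun w' => hv.1.mul (by
      apply Measurable.aestronglyMeasurable; fun_prop)
  · refine (hvi.const_mul c⁻¹).mono' (hv.1.mul (by
      apply Measurable.aestronglyMeasurable; fun_prop)) ?_
    filter_upwards [ae_restrict_mem measurableSet_Ioi] with x hx
    have hx : (0:ℝ) < x := hx
    rw [norm_mul, norm_inv, mul_left_comm, ← mul_inv]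
    gcongr
    exact hcb x hx.le
  · exact hv.1.mul (by apply Measurable.aestronglyMeasurable; fun_prop)
  · filter_upwards [ae_restrict_mem measurableSet_Ioi] with x hx
    intro w' hw'
    have hx : (0:ℝ) < x := hx
    have h1 := hball w' hw' x hx.le
    rw [norm_mul, norm_div, norm_neg, norm_one, norm_pow, one_div, mul_left_comm, ← inv_pow]
    gcongr
    have h2 : ‖(x:ℂ) + w'‖⁻¹ ≤ (c/2)⁻¹ * (1+x)⁻¹ := by
      rw [← mul_inv]; gcongr
    have h3 : (1 + x)⁻¹ ≤ 1 := inv_le_one_of_one_le₀ (by linarith)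
    have h4 : 0 < (1 + x)⁻¹ := by positivity
    calc (‖(x:ℂ) + w'‖⁻¹) ^ 2 ≤ ((c/2)⁻¹ * (1+x)⁻¹) ^ 2 := by gcongr
      _ = (c/2)⁻¹ ^ 2 * ((1+x)⁻¹ * (1 + x)⁻¹) := by ring
      _ ≤ (c/2)⁻¹ ^ 2 * (1 * (1 + x)⁻¹) := by gcongr
      _ = _ := by ring
  · exact hvi.const_mul _
  · filter_upwards [ae_restrict_mem measurableSet_Ioi] with x hx
    intro w' hw'
    have hx : (0:ℝ) < x := hx
    have h1 := hball w' hw' x hx.le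
    have h0 : (x : ℂ) + w' ≠ 0 := by
      intro h; rw [h, norm_zero] at h1
      have : 0 < c / 2 * (1 + x) := by positivity
      linarith
    have := (((hasDerivAt_id w').const_add (x:ℂ)).inv h0).const_mul (v x)
    simpa using this

lemma cauchy_zero (v : ℝ → ℂ) (hv : MemLp v 2 (volume.restrict (Ioi 0)))
    (h : ∀ w : ℂ, w.im < 0 → ∫ x in Ioi (0:ℝ), v x * ((x : ℂ) + w)⁻¹ = 0) (w : ℂ)
    (hw : w ∈ slitPlane) : ∫ x in Ioi (0:ℝ), v x * ((x : ℂ) + w)⁻¹ = 0 := by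
  have hA : AnalyticOnNhd ℂ (fun w : ℂ => ∫ x in Ioi (0:ℝ), v x * ((x : ℂ) + w)⁻¹) slitPlane :=
    DifferentiableOn.analyticOnNhd
      (fun w hw => (cauchy_diff v hv w hw).differentiableWithinAt) isOpen_slitPlane
  have hI : (-I) ∈ slitPlane := Or.inr (by simp)
  have hc : IsPreconnected slitPlane :=
    (starConvex_one_slitPlane.isPathConnected (Or.inl (by simp))).isConnected.isPreconnected
  refine hA.eqOn_zero_of_preconnected_of_eventuallyEq_zero hc hI ?_ hw
  have : {w : ℂ | w.im < 0} ∈ 𝓝 (-I) :=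
    (isOpen_lt Complex.continuous_im continuous_const).mem_nhds (by simp)
  filter_upwards [this] with w hw using h w hw

lemma memLp_two_of_bdd (q : ℝ → ℂ) (h1 : Integrable q volume) (hb : ∀ x, ‖q x‖ ≤ 1) :
    MemLp q 2 volume := by
  rw [memLp_two_iff_integrable_sq_norm h1.1]
  refine h1.norm.mono' (h1.1.norm.pow 2) (Filter.Eventually.of_forall fun x => ?_)
  rw [Real.norm_of_nonneg (by positivity), sq]
  exact mul_le_of_le_one_left (norm_nonneg _) (hb x)

lemma pair_eq (F : L2 →L[ℂ] L2) (hF : IsFourierPlancherel F) (q : ℝ → ℂ) (h2 : MemLp q 2 volume)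
    (h1 : Integrable q volume) (u : L2) :
    ∫ y, u y * conj (q y) = ∫ x : ℝ, F u x * conj (((Real.sqrt (2 * Real.pi) : ℂ))⁻¹ *
      ∫ t : ℝ, q t * Complex.exp (-(Complex.I * t * x))) := by
  have h := Finner F hF (h2.toLp q) u
  rw [L2.inner_def, L2.inner_def] at h
  have e1 : ∫ y, u y * conj (q y) = ∫ a, ⟪(h2.toLp q) a, u a⟫_ℂ := by
    apply integral_congr_ae
    filter_upwards [h2.coeFn_toLp] with x hx
    rw [hx]; simp
  rw [e1, ← h]
  apply integral_congr_ae
  filter_upwards [FF F hF q h2 h1] with x hx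
  rw [hx]
  rw [RCLike.inner_apply]

lemma halfline_zero (F : L2 →L[ℂ] L2) (hF : IsFourierPlancherel F) (u : L2)
    (hu : ∀ᵐ y : ℝ, y < 0 → u y = 0) (hv : ∀ᵐ x : ℝ, x < 0 → F u x = 0) : u = 0 := by
  have hk0 : ((Real.sqrt (2 * Real.pi) : ℂ))⁻¹ ≠ 0 := by
    apply inv_ne_zero
    rw [ofReal_ne_zero]
    positivity
  have hkc : conj ((Real.sqrt (2 * Real.pi) : ℂ))⁻¹ = ((Real.sqrt (2 * Real.pi) : ℂ))⁻¹ := by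
    rw [map_inv₀, conj_ofReal]
  have hne : ∀ᵐ x : ℝ, x ≠ 0 := by simp [ae_iff]
  have hvm : MemLp (F u) 2 (volume.restrict (Ioi 0)) := (Lp.memLp (F u)).restrict _
  -- restrict to the half line
  have hres : ∀ K : ℝ → ℂ, ∫ x, F u x * K x = ∫ x in Ioi 0, F u x * K x := by
    intro K
    rw [← integral_indicator measurableSet_Ioi]
    apply integral_congr_ae
    filter_upwards [hv, hne] with x hx hx0
    by_cases h : 0 < x
    · rw [indicator_of_mem (show x ∈ Ioi 0 from h)]
    · rw [indicator_of_notMem (show x ∉ Ioi 0 from h), hx (lt_of_le_of_ne (not_lt.1 h) hx0),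
        zero_mul]
  have hlow : ∀ w : ℂ, w.im < 0 → ∫ x in Ioi (0:ℝ), F u x * ((x : ℂ) + w)⁻¹ = 0 := by
    intro w hw
    -- w = - I * conj a
    set a : ℂ := conj (I * w) with ha
    have hare : 0 < a.re := by simp [ha]; exact hw
    set q : ℝ → ℂ := (Iic (0:ℝ)).indicator (fun y : ℝ => cexp (a * y)) with hq
    have h1 : Integrable q volume := by
      rw [hq, integrable_indicator_iff measurableSet_Iic]
      exact integrableOn_exp_mul_complex_Iic hare 0
    have h2 : MemLp q 2 volume := by
      apply memLp_two_of_bdd q h1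
      intro x
      rw [hq]
      by_cases h : x ≤ 0
      · rw [indicator_of_mem (show x ∈ Iic 0 from h), norm_exp]
        simp only [re_mul_ofReal, Real.exp_le_one_iff]
        nlinarith
      · rw [indicator_of_notMem (show x ∉ Iic 0 from h)]; simp
    have hp := pair_eq F hF q h2 h1 u
    have hL : ∫ y, u y * conj (q y) = 0 := by
      rw [← integral_zero ℝ ℂ (μ := volume)]
      apply integral_congr_ae
      filter_upwards [hu, hne] with y hy hy0
      by_cases h : y < 0
      · rw [hy h, zero_mul]
      · rw [hq, indicator_of_notMem]
        · simp
        · intro h'; exact h (lt_of_le_of_ne h' hy0)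
    have hFq : ∀ x : ℝ, ∫ t : ℝ, q t * Complex.exp (-(Complex.I * t * x)) = (a - I * x)⁻¹ := by
      intro x
      have e := integral_exp_mul_complex_Iic (a := a - I * x) (by simpa using hare) 0
      rw [← integral_indicator measurableSet_Iic] at e
      simp only [ofReal_zero, mul_zero, Complex.exp_zero, one_div] at e
      rw [← e]
      congr 1
      ext t
      by_cases h : t ∈ Iic (0:ℝ)
      · rw [hq, indicator_of_mem h, indicator_of_mem h, ← Complex.exp_add]
        congr 1; ring
      · rw [hq, indicator_of_notMem h, indicator_of_notMem h, zero_mul]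
    rw [hL, hres] at hp
    have : ∀ x : ℝ, F u x * conj (((Real.sqrt (2 * Real.pi) : ℂ))⁻¹ *
      ∫ t : ℝ, q t * Complex.exp (-(Complex.I * t * x))) =
        (((Real.sqrt (2 * Real.pi) : ℂ))⁻¹ * I⁻¹) * (F u x * ((x : ℂ) + w)⁻¹) := by
      intro x
      rw [hFq, map_mul, hkc, map_inv₀, map_sub, map_mul, conj_ofReal, conj_I, ha, conj_conj]
      have : I * w - -I * x = I * (x + w) := by ring
      rw [this, mul_inv]; ring
    simp_rw [this] at hp
    rw [integral_const_mul] at hp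
    exact (mul_eq_zero.1 hp.symm).resolve_left (mul_ne_zero hk0 (inv_ne_zero I_ne_zero))
  have hall := cauchy_zero _ hvm hlow
  have hup : ∀ a : ℂ, 0 < a.re → ∫ y, u y * conj ((Ioi (0:ℝ)).indicator (fun y : ℝ => cexp (-a * y)) y) = 0 := by
    intro a hare
    set q : ℝ → ℂ := (Ioi (0:ℝ)).indicator (fun y : ℝ => cexp (-a * y)) with hq
    have h1 : Integrable q volume := by
      rw [hq, integrable_indicator_iff measurableSet_Ioi]
      exact integrableOn_exp_mul_complex_Ioi (by simpa using hare) 0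
    have h2 : MemLp q 2 volume := by
      apply memLp_two_of_bdd q h1
      intro x
      rw [hq]
      by_cases h : 0 < x
      · rw [indicator_of_mem (show x ∈ Ioi 0 from h), norm_exp]
        simp only [re_mul_ofReal, Real.exp_le_one_iff, neg_re]
        nlinarith
      · rw [indicator_of_notMem (show x ∉ Ioi 0 from h)]; simp
    have hp := pair_eq F hF q h2 h1 u
    have hFq : ∀ x : ℝ, ∫ t : ℝ, q t * Complex.exp (-(Complex.I * t * x)) = (a + I * x)⁻¹ := by
      intro x
      have e := integral_exp_mul_complex_Ioi (a := -(a + I * x)) (by simpa using hare) 0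
      rw [← integral_indicator measurableSet_Ioi] at e
      simp only [ofReal_zero, mul_zero, Complex.exp_zero, neg_div_neg_eq, one_div] at e
      rw [← e]
      congr 1
      ext t
      by_cases h : t ∈ Ioi (0:ℝ)
      · rw [hq, indicator_of_mem h, indicator_of_mem h, ← Complex.exp_add]
        congr 1; ring
      · rw [hq, indicator_of_notMem h, indicator_of_notMem h, zero_mul]
    rw [hres] at hp
    have : ∀ x : ℝ, F u x * conj (((Real.sqrt (2 * Real.pi) : ℂ))⁻¹ *
      ∫ t : ℝ, q t * Complex.exp (-(Complex.I * t * x))) =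
        (((Real.sqrt (2 * Real.pi) : ℂ))⁻¹ * (-I)⁻¹) * (F u x * ((x : ℂ) + I * conj a)⁻¹) := by
      intro x
      rw [hFq, map_mul, hkc, map_inv₀, map_add, map_mul, conj_ofReal, conj_I]
      have : conj a + -I * x = (-I) * (x + I * conj a) := by
        linear_combination (conj a) * I_sq
      rw [this, mul_inv]; ring
    simp_rw [this] at hp
    rw [integral_const_mul, hall (I * conj a) (Or.inr (by simpa using hare.ne')), mul_zero] at hp
    exact hp
  -- now conclude
  set p : ℝ → ℂ := (Ioi (0:ℝ)).indicator (fun y : ℝ => cexp (-1 * y)) with hpdef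
  have hpb : ∀ x, ‖p x‖ ≤ 1 := by
    intro x
    rw [hpdef]
    by_cases h : 0 < x
    · rw [indicator_of_mem (show x ∈ Ioi 0 from h), norm_exp]
      simp only [re_mul_ofReal, Real.exp_le_one_iff, neg_re, one_re]
      nlinarith
    · rw [indicator_of_notMem (show x ∉ Ioi 0 from h)]; simp
  have hp1 : Integrable p volume := by
    rw [hpdef, integrable_indicator_iff measurableSet_Ioi]
    exact integrableOn_exp_mul_complex_Ioi (by simp) 0
  have hp2 : MemLp p 2 volume := memLp_two_of_bdd p hp1 hpb
  have hz := q_zero F hF (fun y => u y * p y)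
    ((Lp.memLp u).of_le_mul (c := 1) ((Lp.aestronglyMeasurable u).mul hp1.1)
      (Filter.Eventually.of_forall fun x => by
        rw [norm_mul, mul_comm]; gcongr; exact hpb x))
    ((Lp.memLp u).integrable_mul hp2) (by
      intro ω
      rw [← hup (1 - I * ω) (by simp)]
      congr 1
      ext t
      rw [mul_assoc, hpdef]
      congr 1
      by_cases h : t ∈ Ioi (0:ℝ)
      · rw [indicator_of_mem h, indicator_of_mem h, ← Complex.exp_add, ← Complex.exp_conj]
        congr 1
        simp only [map_mul, map_neg, map_sub, map_one, conj_I, conj_ofReal]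
        ring
      · rw [indicator_of_notMem h, indicator_of_notMem h, zero_mul, map_zero])
  apply Lp.ext
  filter_upwards [hz, hu, hne, Lp.coeFn_zero ℂ 2 (volume : Measure ℝ)] with x h1 h2 h3 h4
  rw [h4]
  rcases lt_or_gt_of_ne h3 with h | h
  · exact h2 h
  · simp only [Pi.zero_apply, mul_eq_zero, hpdef] at h1
    rw [indicator_of_mem (show x ∈ Ioi 0 from h)] at h1
    exact h1.resolve_right (Complex.exp_ne_zero _)

def Gs (b c d : ℂ) (x : ℝ) : ℂ := cexp (b * x ^ 2 + c * x + d)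

lemma Gs_int {b : ℂ} (hb : b.re < 0) (c d : ℂ) : Integrable (Gs b c d) volume :=
  integrable_cexp_quadratic' hb c d

lemma Gs_mem {b : ℂ} (hb : b.re < 0) (c d : ℂ) : MemLp (Gs b c d) 2 volume := by
  rw [memLp_two_iff_integrable_sq_norm (Gs_int hb c d).1]
  have h := (Gs_int (b := 2 * b) (by simp; linarith) (2 * c) (2 * d)).norm
  refine h.congr (Filter.Eventually.of_forall fun x => ?_)
  simp only [Gs]
  rw [← norm_pow, ← Complex.exp_nat_mul]
  congr 2; push_cast; ring

def Kc (b : ℂ) : ℂ := ((Real.sqrt (2 * Real.pi) : ℂ))⁻¹ * ((Real.pi : ℂ) / -b) ^ (1 / 2 : ℂ)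

lemma Kc_ne {b : ℂ} (hb : b.re < 0) : Kc b ≠ 0 := by
  have hb' : b ≠ 0 := by contrapose! hb; rw [hb, zero_re]
  unfold Kc
  apply mul_ne_zero
  · apply inv_ne_zero
    rw [ofReal_ne_zero]
    positivity
  · rw [Ne, cpow_eq_zero_iff]
    rintro ⟨h, -⟩
    simp [hb', Real.pi_ne_zero] at h

lemma F_Gs (F : L2 →L[ℂ] L2) (hF : IsFourierPlancherel F) {b : ℂ} (hb : b.re < 0) (c d : ℂ) :
    ⇑(F ((Gs_mem hb c d).toLp _)) =ᵐ[volume]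
      fun x : ℝ => Kc b * cexp (d - (c - I * x) ^ 2 / (4 * b)) := by
  refine (FF F hF _ (Gs_mem hb c d) (Gs_int hb c d)).trans (Filter.Eventually.of_forall fun x => ?_)
  dsimp only
  rw [Kc, mul_assoc, ← integral_cexp_quadratic hb]
  congr 2
  ext t
  rw [Gs, ← Complex.exp_add]
  congr 1; ring

lemma half_neg : (-(1/2) : ℂ).re < 0 := by norm_num

lemma gauss_dense (F : L2 →L[ℂ] L2) (hF : IsFourierPlancherel F) :
    Dense (Submodule.span ℂ (range fun β : ℝ => (Gs_mem half_neg (I * β) 0).toLp _) : Set L2) := by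
  rw [Submodule.dense_iff_topologicalClosure_eq_top, Submodule.topologicalClosure_eq_top_iff,
    Submodule.eq_bot_iff]
  intro h hh
  rw [Submodule.mem_orthogonal] at hh
  have h0 : ∀ β : ℝ, ∫ x, h x * conj (Gs (-(1/2)) (I * β) 0 x) = 0 := by
    intro β
    have := hh _ (Submodule.subset_span ⟨β, rfl⟩)
    rw [L2.inner_def] at this
    refine Eq.trans (integral_congr_ae ?_) this
    filter_upwards [(Gs_mem half_neg (I * β) 0).coeFn_toLp] with x hx
    rw [hx, RCLike.inner_apply]
  have hz := q_zero F hF (fun y => h y * Gs (-(1/2)) 0 0 y)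
    ((Lp.memLp h).of_le_mul (c := 1) ((Lp.aestronglyMeasurable h).mul (Gs_int half_neg 0 0).1)
      (Filter.Eventually.of_forall fun x => by
        rw [norm_mul, mul_comm]; gcongr
        rw [Gs, norm_exp, Real.exp_le_one_iff]
        have : (-(1/2) * (x:ℂ) ^ 2 + 0 * x + 0) = ((-(1/2) * x ^ 2 : ℝ) : ℂ) := by push_cast; ring
        rw [this, ofReal_re]
        nlinarith [sq_nonneg x]))
    ((Lp.memLp h).integrable_mul (Gs_mem half_neg 0 0)) (by
      intro ω
      refine Eq.trans ?_ (h0 ω)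
      congr 1
      ext t
      rw [mul_assoc, Gs, Gs, ← Complex.exp_add, ← Complex.exp_conj]
      congr 2
      simp only [map_mul, map_neg, map_add, map_zero, map_pow, map_div₀, map_one, conj_I,
        conj_ofReal, map_ofNat]
      ring)
  apply Lp.ext
  filter_upwards [hz, Lp.coeFn_zero ℂ 2 (volume : Measure ℝ)] with x h1 h4
  rw [h4]
  simp only [Pi.zero_apply, mul_eq_zero, Gs] at h1
  exact h1.resolve_right (Complex.exp_ne_zero _)

lemma expo (s : ℝ) (hs : 0 < s) (β x : ℝ) :
    -(β : ℂ) ^ 2 / 2 - (β - I * x) ^ 2 / (4 * (-(1/2) + I / (2 * s))) =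
      -(I * s * x ^ 2) / 2 + (0 - (I * β - I * ((s * x : ℝ) : ℂ)) ^ 2 / (4 * (-(1/2) - I * s / 2))) := by
  have hs' : (s : ℂ) ≠ 0 := ofReal_ne_zero.2 hs.ne'
  have hD : 1 + I * (s : ℂ) ≠ 0 := by
    intro h
    have := congrArg Complex.re h
    simp at this
  have e1 : 4 * (-(1/2) + I / (2 * (s:ℂ))) = 2 * I * (1 + I * s) / s := by
    field_simp
    linear_combination (-4 * (s:ℂ)) * I_sq
  have e2 : 4 * (-(1/2) - I * (s:ℂ) / 2) = -(2 * (1 + I * s)) := by ring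
  rw [e1, e2]
  have e3 : ((β:ℂ) - I * x) ^ 2 / (2 * I * (1 + I * s) / s) =
      - (I * s * ((β:ℂ) - I * x) ^ 2) / (2 * (1 + I * s)) := by
    have := I_ne_zero
    field_simp
    linear_combination ((β:ℂ) - I * x) ^ 2 * I_sq
  rw [e3]
  push_cast
  field_simp
  linear_combination (-2*s*β*x + I*s*x^2 + s^2*x^2 - (β - s * x)^2) * I_sq

lemma chirp_cont (r : ℝ) : Continuous (fun x : ℝ => cexp (I * r * x ^ 2)) := by fun_prop

lemma chirp_norm (r : ℝ) (x : ℝ) : ‖cexp (I * r * x ^ 2)‖ ≤ 1 := by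
  have : I * r * (x:ℂ) ^ 2 = ((r * x ^ 2 : ℝ) : ℂ) * I := by push_cast; ring
  rw [this, norm_exp_ofReal_mul_I]

lemma core (F : L2 →L[ℂ] L2) (hF : IsFourierPlancherel F) (s : ℝ) (hs : 0 < s) (g₁ g₂ : L2)
    (h1 : g₁ ∈ H2 F) (h2 : g₂ ∈ H2 F)
    (h : ⇑g₁ =ᵐ[volume] fun x : ℝ => cexp (-(I * s * x ^ 2) / 2) * g₂ x) : g₂ = 0 := by
  have hs' : (s : ℂ) ≠ 0 := ofReal_ne_zero.2 hs.ne'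
  obtain ⟨Mφ, hφ⟩ := exists_dil 1 one_ne_zero _ (chirp_cont (-s/2)) (chirp_norm _)
  obtain ⟨Mψ, hψ⟩ := exists_dil 1 one_ne_zero _ (chirp_cont (1/(2*s))) (chirp_norm _)
  obtain ⟨W, hW⟩ := exists_dil s hs.ne' _ (chirp_cont (-s/2)) (chirp_norm _)
  have hq : Measure.QuasiMeasurePreserving (fun x : ℝ => s * x) volume volume := by
    refine ⟨by fun_prop, ?_⟩
    rw [Real.map_volume_mul_left hs.ne']
    exact Measure.smul_absolutelyContinuous
  set b1 : ℂ := -(1/2) + I / (2 * s) with hb1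
  set b2 : ℂ := -(1/2) - I * s / 2 with hb2
  have hb1n : b1.re < 0 := by
    have : b1 = ((-(1/2) : ℝ) : ℂ) + ((1 / (2 * s) : ℝ) : ℂ) * I := by
      rw [hb1]; push_cast; ring
    rw [this]; simp
  have hb2n : b2.re < 0 := by
    have : b2 = ((-(1/2) : ℝ) : ℂ) + ((-s/2 : ℝ) : ℂ) * I := by
      rw [hb2]; push_cast; ring
    rw [this]; simp
  set c : ℂ := Kc (-(1/2)) * Kc b1 / Kc b2 with hc
  have hop : F.comp (Mψ.comp F) = c • (W.comp (F.comp Mφ)) := by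
    apply ContinuousLinearMap.ext_on (gauss_dense F hF)
    rintro _ ⟨β, rfl⟩
    dsimp only
    set g := (Gs_mem half_neg (I * β) 0).toLp _ with hg
    have e1 : Mψ (F g) = Kc (-(1/2)) • (Gs_mem hb1n β (-(β:ℂ)^2/2)).toLp _ := by
      apply Lp.ext
      filter_upwards [hψ (F g), F_Gs F hF half_neg (I * β) 0,
        Lp.coeFn_smul (Kc (-(1/2))) ((Gs_mem hb1n β (-(β:ℂ)^2/2)).toLp _),
        (Gs_mem hb1n β (-(β:ℂ)^2/2)).coeFn_toLp] with x a1 a2 a3 a4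
      rw [a1, a3, Pi.smul_apply, a4, one_mul, hg, a2, smul_eq_mul, Gs, mul_left_comm,
        ← Complex.exp_add]
      congr 2
      rw [hb1]
      push_cast
      field_simp
      linear_combination (4 * (s:ℂ) * (β - x) ^ 2) * I_sq
    have e2 : Mφ g = (Gs_mem hb2n (I * β) 0).toLp _ := by
      apply Lp.ext
      filter_upwards [hφ g, (Gs_mem half_neg (I * β) 0).coeFn_toLp,
        (Gs_mem hb2n (I * β) 0).coeFn_toLp] with x a1 a2 a3
      rw [a1, a3, one_mul, hg, a2, Gs, Gs, ← Complex.exp_add]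
      congr 1
      rw [hb2]
      push_cast
      ring
    simp only [ContinuousLinearMap.comp_apply, _root_.smul_apply]
    rw [e1, e2, map_smul]
    apply Lp.ext
    filter_upwards [Lp.coeFn_smul (Kc (-(1/2))) (F ((Gs_mem hb1n β (-(β:ℂ)^2/2)).toLp _)),
      Lp.coeFn_smul c (W (F ((Gs_mem hb2n (I * β) 0).toLp _))),
      F_Gs F hF hb1n β (-(β:ℂ)^2/2), hW (F ((Gs_mem hb2n (I * β) 0).toLp _)),
      hq.ae (F_Gs F hF hb2n (I * β) 0)] with x a1 a2 a3 a4 a5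
    rw [a1, a2, Pi.smul_apply, Pi.smul_apply, a3, a4, a5, smul_eq_mul, smul_eq_mul, hb1,
      expo s hs β x, ← hb1, ← hb2, Complex.exp_add, hc]
    have := Kc_ne hb2n
    have e : I * ((-s / 2 : ℝ) : ℂ) * (x:ℂ) ^ 2 = -(I * s * x ^ 2) / 2 := by push_cast; ring
    rw [e]
    field_simp
  have hφg : Mφ g₂ = g₁ := by
    apply Lp.ext
    filter_upwards [hφ g₂, h] with x a1 a2
    rw [a1, a2, one_mul]
    congr 2
    push_cast; ring
  have hu : Mψ (F g₂) = 0 := by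
    apply halfline_zero F hF
    · filter_upwards [hψ (F g₂), h2] with x a1 a2 hx
      rw [a1, one_mul, a2 hx, mul_zero]
    · have e : F (Mψ (F g₂)) = c • W (F g₁) := by
        have := congrArg (fun T : L2 →L[ℂ] L2 => T g₂) hop
        simpa [hφg] using this
      rw [e]
      filter_upwards [Lp.coeFn_smul c (W (F g₁)), hW (F g₁), hq.ae h1] with x a1 a2 a3 hx
      rw [a1, Pi.smul_apply, a2, a3 (mul_neg_of_pos_of_neg hs hx)]
      simp
  apply Finj F hF
  apply Lp.ext
  have a1 := hψ (F g₂)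
  rw [hu] at a1
  filter_upwards [a1, Lp.coeFn_zero ℂ 2 (volume : Measure ℝ)] with x b1 b2
  rw [b2, one_mul] at b1
  rw [b2]
  exact (mul_eq_zero.1 b1.symm).resolve_left (Complex.exp_ne_zero _)

lemma core' (F : L2 →L[ℂ] L2) (hF : IsFourierPlancherel F) (s₁ s₂ : ℝ) (hs : s₁ < s₂) (f g₁ g₂ : L2)
    (hg1 : g₁ ∈ H2 F) (hg2 : g₂ ∈ H2 F)
    (h1 : ⇑f =ᵐ[volume] fun x : ℝ => Complex.exp (-(Complex.I * s₁ * x ^ 2) / 2) * g₁ x)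
    (h2 : ⇑f =ᵐ[volume] fun x : ℝ => Complex.exp (-(Complex.I * s₂ * x ^ 2) / 2) * g₂ x) :
    f = 0 := by
  have hz : g₂ = 0 := by
    apply core F hF (s₂ - s₁) (sub_pos.2 hs) g₁ g₂ hg1 hg2
    filter_upwards [h1, h2] with x a1 a2
    rw [a1] at a2
    apply mul_left_cancel₀ (Complex.exp_ne_zero (-(Complex.I * s₁ * x ^ 2) / 2))
    rw [a2, ← mul_assoc, ← Complex.exp_add]
    congr 2
    push_cast; ring
  apply Lp.ext
  rw [hz] at h2
  filter_upwards [h2, Lp.coeFn_zero ℂ 2 (volume : Measure ℝ)] with x a1 a2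
  rw [a1, a2]; simp
 
/-- For distinct `s₁, s₂ ≥ 0` the subspaces `M_{φ_{s₁}}H²(ℝ)` and `M_{φ_{s₂}}H²(ℝ)`
intersect trivially, where `φ_s(x) = e^{−isx²/2}`. -/
theorem distinct_phi_s_H2_trivial_intersection (F : L2 →L[ℂ] L2)
    (hF : IsFourierPlancherel F)
    (s₁ s₂ : ℝ) (hs₁ : 0 ≤ s₁) (hs₂ : 0 ≤ s₂) (hne : s₁ ≠ s₂) (f : L2)
    (h1 : ∃ g ∈ H2 F, ⇑f =ᵐ[volume] fun x : ℝ => Complex.exp (-(Complex.I * s₁ * x ^ 2) / 2) * g x)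
    (h2 : ∃ g ∈ H2 F, ⇑f =ᵐ[volume] fun x : ℝ => Complex.exp (-(Complex.I * s₂ * x ^ 2) / 2) * g x) :
    f = 0 := by

  obtain ⟨g₁, hg1, e1⟩ := h1
  obtain ⟨g₂, hg2, e2⟩ := h2
  rcases lt_or_gt_of_ne hne with h | h
  · exact core' F hF s₁ s₂ h f g₁ g₂ hg1 hg2 e1 e2
  · exact core' F hF s₂ s₁ h f g₂ g₁ hg2 hg1 e2 e1
end
end

section
/- Any proper subspace of the analytic nest and any proper subspace of the Volterra nest intersect trivially: for all s, t ∈ ℝ, (e^{isx} H²(ℝ)) ∩ L²([t, ∞)) = {0}. -/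
open MeasureTheory Complex Filter Set

noncomputable section

open FourierTransform in
lemma av_fourier_inj (h : ℝ → ℂ) (hi : Integrable h)
    (h0 : ∀ w : ℝ, ∫ y : ℝ, Complex.exp (-(Complex.I * w * y)) * h y = 0) :
    ∀ᵐ x, h x = 0 := by
  have hF : ∀ w, 𝓕 h w = 0 := by
    intro w
    rw [Real.fourier_real_eq_integral_exp_smul]
    rw [← h0 (2 * Real.pi * w)]
    congr 1; ext y
    rw [smul_eq_mul]; congr 2; push_cast; ring
  apply ae_eq_zero_of_integral_contDiff_smul_eq_zero hi.locallyIntegrable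
  intro g hg hgc
  have hg₁ : HasCompactSupport (Complex.ofRealCLM ∘ g) := hgc.comp_left rfl
  have hg₂ : ContDiff ℝ (⊤ : ℕ∞) (Complex.ofRealCLM ∘ g) := by fun_prop
  let φ : SchwartzMap ℝ ℂ := hg₁.toSchwartzMap hg₂
  let ψ : SchwartzMap ℝ ℂ := 𝓕⁻ φ
  have hψ : 𝓕 ψ = φ := by simp [ψ]
  have key := VectorFourier.integral_fourierIntegral_smul_eq_flip (L := innerₗ ℝ) (μ := volume) (ν := volume)
      Real.continuous_fourierChar continuous_inner ψ.integrable hi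
  have e1 : ∀ x, VectorFourier.fourierIntegral Real.fourierChar volume (innerₗ ℝ) (⇑ψ) x = (g x : ℂ) := by
    intro x
    have : (𝓕 ψ : SchwartzMap ℝ ℂ) x = φ x := by rw [hψ]
    rw [SchwartzMap.fourier_coe] at this
    exact this
  have e2 : ∀ x, VectorFourier.fourierIntegral Real.fourierChar volume (innerₗ ℝ).flip h x = 0 := by
    intro x
    rw [flip_innerₗ]
    exact hF x
  simp only [e1, e2, smul_zero, integral_zero] at key
  rw [← key]
  simp

def avV (p : ℂ) (y : ℝ) : ℂ := ((max y 0 : ℝ) : ℂ) * Complex.exp (-(p * y))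

lemma avV_cont (p : ℂ) : Continuous (avV p) := by unfold avV; fun_prop

lemma avV_neg (p : ℂ) {y : ℝ} (hy : y ≤ 0) : avV p y = 0 := by simp [avV, hy]

lemma avV_int (p : ℂ) (hp : 0 < p.re) : Integrable (avV p) := by
  have h := integrableOn_rpow_mul_exp_neg_mul_rpow (p := 1) (s := 1) (b := p.re) (by norm_num) (by norm_num) hp
  have h2 : IntegrableOn (avV p) (Ioi 0) := by
    refine Integrable.mono' h (avV_cont p).aestronglyMeasurable ?_
    filter_upwards [ae_restrict_mem measurableSet_Ioi] with y hy
    have hy' : (0:ℝ) < y := hy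
    simp [avV, max_eq_left hy'.le, abs_of_pos hy', Complex.norm_exp]
  refine (integrableOn_iff_integrable_of_support_subset ?_).1 h2
  intro y hy
  by_contra hc
  exact hy (avV_neg p (not_lt.1 hc))

lemma avV_laplace (q : ℂ) (hq : 0 < q.re) : ∫ y : ℝ, avV q y = (q ^ 2)⁻¹ := by
  have hq0 : q ≠ 0 := by rintro rfl; simp at hq
  have e : ∫ y : ℝ, avV q y = ∫ y in Ioi (0:ℝ), avV q y := by
    rw [setIntegral_eq_integral_of_forall_compl_eq_zero]
    intro y hy; exact avV_neg q (not_lt.1 hy)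
  rw [e]
  have := integral_Ioi_of_hasDerivAt_of_tendsto (a := 0) (m := 0)
    (f := fun y : ℝ => -((y : ℂ) / q + (q^2)⁻¹) * Complex.exp (-(q * y))) (f' := avV q) ?_ ?_ (avV_int q hq).integrableOn ?_
  · rw [this]; simp
  · fun_prop
  · intro y hy
    have hy' : (0:ℝ) < y := hy
    have h1 : HasDerivAt (fun y : ℝ => (y : ℂ)) 1 y := Complex.ofRealCLM.hasDerivAt
    have h2 := (((h1.div_const q).add_const ((q^2)⁻¹)).neg).mul ((h1.const_mul q).neg.cexp)
    refine h2.congr_deriv ?_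
    simp only [avV, max_eq_left hy'.le, Pi.neg_apply]
    field_simp
    ring
  · rw [tendsto_zero_iff_norm_tendsto_zero]
    have t1 := Real.tendsto_pow_mul_exp_neg_atTop_nhds_zero 1
    have t0 := Real.tendsto_pow_mul_exp_neg_atTop_nhds_zero 0
    have hl : Tendsto (fun y : ℝ => q.re * y) atTop atTop := tendsto_id.const_mul_atTop hq
    have t := ((t1.comp hl).const_mul (‖q‖⁻¹ * q.re⁻¹)).add ((t0.comp hl).const_mul (‖q^2‖⁻¹))
    simp only [mul_zero, add_zero] at t
    refine squeeze_zero' (Eventually.of_forall fun y => norm_nonneg _) ?_ t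
    filter_upwards [eventually_gt_atTop 0] with y hy
    simp only [norm_mul, norm_neg, Complex.norm_exp, Function.comp, pow_one, pow_zero, one_mul]
    have : ‖(y:ℂ) / q + (q^2)⁻¹‖ ≤ y * ‖q‖⁻¹ + ‖q^2‖⁻¹ := by
      refine (norm_add_le _ _).trans ?_
      simp [abs_of_pos hy, div_eq_mul_inv]
    have e3 : (-(q * (y:ℂ))).re = -(q.re * y) := by simp
    rw [e3]
    calc _ ≤ (y * ‖q‖⁻¹ + ‖q^2‖⁻¹) * Real.exp (-(q.re * y)) := by gcongr
      _ = _ := by field_simp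

lemma av_K_bound (p : ℂ) (hp : 0 < p.re) : ∃ C : ℝ, ∀ x : ℝ, ‖((p + Complex.I * x)^2)⁻¹‖ ≤ C * (1 + x^2)⁻¹ := by
  -- |p+ix|^2 = a^2+(b+x)^2 
  set a := p.re
  set b := p.im
  refine ⟨(1 + 2 * b^2 + 2*a^2)/a^2, fun x => ?_⟩
  have h1 : ‖(p + Complex.I * x)^2‖ = a^2 + (b+x)^2 := by
    rw [norm_pow, ← Complex.normSq_eq_norm_sq, Complex.normSq_apply]; simp [a, b]; ring
  rw [norm_inv, h1]
  have : 0 < a^2 + (b+x)^2 := by positivity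
  rw [div_mul_eq_mul_div, ← div_eq_mul_inv, div_div, inv_le_comm₀ this (by positivity), inv_div, div_le_iff₀ (by positivity)]
  nlinarith [sq_nonneg (x + 2*b), mul_pos hp hp, mul_nonneg (sq_nonneg a) (sq_nonneg (x+2*b)), sq_nonneg (b*(b+x)), sq_nonneg (a*(b+x)), sq_nonneg (a^2), sq_nonneg (a*b), sq_nonneg (b+x)]

lemma av_p_ne (p : ℂ) (hp : 0 < p.re) (x : ℝ) : p + Complex.I * x ≠ 0 := by
  intro h
  have := congrArg Complex.re h
  simp at this; linarith

lemma av_K_cont (p : ℂ) (hp : 0 < p.re) : Continuous (fun x : ℝ => ((p + Complex.I * x)^2)⁻¹) := by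
  refine Continuous.inv₀ (by fun_prop) fun x => pow_ne_zero 2 (av_p_ne p hp x)

lemma av_K_int (p : ℂ) (hp : 0 < p.re) : Integrable (fun x : ℝ => ((p + Complex.I * x)^2)⁻¹) := by
  obtain ⟨C, hC⟩ := av_K_bound p hp
  exact Integrable.mono' (integrable_inv_one_add_sq.const_mul C) (av_K_cont p hp).aestronglyMeasurable (Eventually.of_forall hC)

lemma av_K_memLp (p : ℂ) (hp : 0 < p.re) : MemLp (fun x : ℝ => ((p + Complex.I * x)^2)⁻¹) 2 volume := by
  obtain ⟨C, hC⟩ := av_K_bound p hp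
  have hC0 : 0 ≤ C := by simpa using (norm_nonneg _).trans (hC 0)
  rw [memLp_two_iff_integrable_sq_norm (av_K_cont p hp).aestronglyMeasurable]
  refine Integrable.mono' (integrable_inv_one_add_sq.const_mul (C^2)) ((av_K_cont p hp).norm.pow 2).aestronglyMeasurable (Eventually.of_forall fun x => ?_)
  have h1 : (1 + x^2)⁻¹ ≤ 1 := inv_le_one_of_one_le₀ (by nlinarith [sq_nonneg x])
  have h2 : 0 < (1+x^2)⁻¹ := by positivity
  rw [Real.norm_of_nonneg (by positivity)]
  calc _ ≤ (C * (1 + x^2)⁻¹)^2 := by gcongr; exact hC x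
    _ = C^2 * ((1+x^2)⁻¹ * (1+x^2)⁻¹) := by ring
    _ ≤ C^2 * ((1+x^2)⁻¹ * 1) := by gcongr
    _ = _ := by ring

open FourierTransform in
lemma av_K_fourier (p : ℂ) (hp : 0 < p.re) (ξ : ℝ) :
    ∫ x : ℝ, ((p + Complex.I * x)^2)⁻¹ * Complex.exp (-(Complex.I * x * ξ)) = 2 * Real.pi * avV p (-ξ) := by
  have hf : 𝓕 (avV p) = fun x : ℝ => ((p + Complex.I * ((2 * Real.pi * x : ℝ) : ℂ))^2)⁻¹ := by
    ext w
    rw [Real.fourier_real_eq_integral_exp_smul, ← avV_laplace _ (by simpa using hp)]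
    congr 1; ext y
    simp only [avV, smul_eq_mul]
    rw [mul_left_comm, ← Complex.exp_add]
    congr 2; push_cast; ring
  have hpi : (2 * Real.pi) ≠ 0 := by positivity
  have hinv := (avV_cont p).fourierInv_fourier_eq (avV_int p hp) (by
    rw [hf]
    exact (av_K_int p hp).comp_mul_left' hpi)
  have h1 := congrFun hinv (-ξ)
  rw [← h1, hf, Real.fourierInv_eq']
  have := Measure.integral_comp_mul_left (fun x : ℝ => ((p + Complex.I * x)^2)⁻¹ * Complex.exp (-(Complex.I * x * ξ))) (2 * Real.pi)
  have e : ∫ v : ℝ, cexp (((2 * Real.pi * inner ℝ v (-ξ) : ℝ) : ℂ) * I) • ((p + Complex.I * ((2 * Real.pi * v : ℝ) : ℂ))^2)⁻¹ =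
     ∫ x : ℝ, (fun x : ℝ => ((p + Complex.I * x)^2)⁻¹ * Complex.exp (-(Complex.I * x * ξ))) (2 * Real.pi * x) := by
    congr 1; ext v
    simp only [smul_eq_mul]
    rw [mul_comm]; congr 2
    simp; ring
  rw [e, this, abs_of_pos (by positivity)]
  rw [Complex.real_smul]
  have hpc : ((2 * Real.pi : ℝ) : ℂ) ≠ 0 := by exact_mod_cast hpi
  rw [Complex.ofReal_inv]
  have h3 : (2 * (Real.pi : ℂ)) = ((2 * Real.pi : ℝ) : ℂ) := by push_cast; ring
  rw [h3, mul_inv_cancel_left₀ hpc]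

open ComplexConjugate in
lemma av_pair (F : L2 →L[ℂ] L2) (hF : IsFourierPlancherel F) (g : L2) (K V : ℝ → ℂ)
    (hK : Integrable K) (hK2 : MemLp K 2 volume)
    (hV : ∀ ξ : ℝ, ∫ x : ℝ, K x * Complex.exp (-(Complex.I * x * ξ)) = V ξ) :
    Integrable (fun ξ => F g ξ * conj (V ξ)) ∧
    ∫ x, g x * conj (K x) = ((Real.sqrt (2 * Real.pi) : ℂ))⁻¹ * ∫ ξ, F g ξ * conj (V ξ) := by
  set c : ℂ := ((Real.sqrt (2 * Real.pi) : ℂ))⁻¹ with hc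
  have hc0 : c ≠ 0 := by
    rw [hc]; apply inv_ne_zero; exact_mod_cast (Real.sqrt_pos.2 (by positivity)).ne'
  have hcc : conj c = c := by rw [hc, map_inv₀, Complex.conj_ofReal]
  obtain ⟨hiso, -, hform⟩ := hF
  let k : L2 := hK2.toLp K
  have hk : ⇑k =ᵐ[volume] K := hK2.coeFn_toLp
  have hFk : ⇑(F k) =ᵐ[volume] fun ξ => c * V ξ := by
    refine (hform k (hK.congr hk.symm)).trans (Eventually.of_forall fun ξ => ?_)
    simp only
    rw [← hV]
    congr 1
    refine integral_congr_ae ?_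
    filter_upwards [hk] with x hx
    rw [hx]
  let Fi : L2 →ₗᵢ[ℂ] L2 := ⟨F.toLinearMap, fun x => by
    have := hiso.dist_eq x 0
    simpa using this⟩
  have hin : inner ℂ (F k) (F g) = inner ℂ k g := Fi.inner_map_map k g
  have hint := L2.integrable_inner (𝕜 := ℂ) (F k) (F g)
  rw [L2.inner_def, L2.inner_def] at hin
  have e1 : (fun ξ => inner ℂ (F k ξ) (F g ξ)) =ᵐ[volume] fun ξ => c * (F g ξ * conj (V ξ)) := by
    filter_upwards [hFk] with ξ h
    rw [h, RCLike.inner_apply, map_mul, hcc]; ring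
  have e2 : (fun ξ => inner ℂ (k ξ) (g ξ)) =ᵐ[volume] fun ξ => (g ξ * conj (K ξ)) := by
    filter_upwards [hk] with ξ h
    rw [h, RCLike.inner_apply]
  constructor
  · have := (hint.congr e1).const_mul c⁻¹
    simpa [hc0] using this
  · rw [integral_congr_ae e1, integral_congr_ae e2, integral_const_mul] at hin
    exact hin.symm

lemma av_lower (w₀ : ℂ) (hw : w₀ ∈ slitPlane) : ∃ ε > 0, ∃ c > 0, ∀ w ∈ Metric.ball w₀ ε,
    ∀ y : ℝ, 0 ≤ y → c * (1 + y) ≤ ‖(y : ℂ) + w‖ := by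
  obtain ⟨ε, hε, hb⟩ := Metric.nhds_basis_closedBall.mem_iff.1 (isOpen_slitPlane.mem_nhds hw)
  have hcomp : IsCompact (Icc (0:ℝ) 1 ×ˢ Metric.closedBall w₀ ε) :=
    isCompact_Icc.prod (isCompact_closedBall w₀ ε)
  obtain ⟨q, hq, hmin⟩ := hcomp.exists_isMinOn
    ⟨((0:ℝ), w₀), by simp [hε.le]⟩
    (f := fun q : ℝ × ℂ => ‖(q.1 : ℂ) + (1 - q.1) * q.2‖) (by fun_prop)
  have key : ∀ q ∈ Icc (0:ℝ) 1 ×ˢ Metric.closedBall w₀ ε, (q.1 : ℂ) + (1 - q.1) * q.2 ∈ slitPlane := by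
    rintro ⟨l, w⟩ ⟨⟨h0, h1⟩, h2⟩
    have := starConvex_one_slitPlane (hb h2) h0 (sub_nonneg.2 h1) (by ring)
    simpa using this
  refine ⟨ε, hε, _, norm_pos_iff.2 (slitPlane_ne_zero (key q hq)), fun w hwb y hy => ?_⟩
  have hy1 : (0:ℝ) < 1 + y := by linarith
  have hy1c : (1 + (y:ℂ)) ≠ 0 := by exact_mod_cast hy1.ne'
  have hm := hmin (a := (y / (1 + y), w)) ⟨⟨by positivity, by rw [div_le_one hy1]; linarith⟩,
    Metric.ball_subset_closedBall hwb⟩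
  have e : (y : ℂ) + w = (((y / (1+y) : ℝ) : ℂ) + (1 - ((y/(1+y) : ℝ) : ℂ)) * w) * ((1 + y : ℝ) : ℂ) := by
    push_cast; field_simp; ring
  rw [e, norm_mul, Complex.norm_real, Real.norm_of_nonneg hy1.le]
  gcongr
  exact hm

lemma av_B_int (g : L2) (t : ℝ) : Integrable (fun x => ‖g x‖ * (1 + (x - t)^2)⁻¹) := by
  have hB : Integrable (fun x : ℝ => (1 + (x - t)^2)⁻¹) := integrable_inv_one_add_sq.comp_sub_right t
  have hc : Continuous (fun x : ℝ => (1 + (x - t)^2)⁻¹) :=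
    Continuous.inv₀ (by fun_prop) fun x => by positivity
  have hB2 : MemLp (fun x : ℝ => (1 + (x - t)^2)⁻¹) 2 volume := by
    rw [memLp_two_iff_integrable_sq hc.aestronglyMeasurable]
    refine hB.mono' (hc.pow 2).aestronglyMeasurable (Eventually.of_forall fun x => ?_)
    have h1 : (1 + (x-t)^2)⁻¹ ≤ 1 := inv_le_one_of_one_le₀ (by nlinarith [sq_nonneg (x-t)])
    have h2 : 0 < (1+(x-t)^2)⁻¹ := by positivity
    rw [Real.norm_of_nonneg (by positivity)]
    nlinarith
  exact (Lp.memLp g).norm.integrable_mul hB2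

lemma av_diff (g : L2) (t : ℝ) (hg : ∀ᵐ x : ℝ ∂volume, x < t → g x = 0) :
    DifferentiableOn ℂ (fun w : ℂ => ∫ x : ℝ, g x * ((((x - t : ℝ) : ℂ) + w)^2)⁻¹) slitPlane := by
  intro w₀ hw
  obtain ⟨ε, hε, c, hc, hlow⟩ := av_lower w₀ hw
  have hgm : AEStronglyMeasurable (⇑g) volume := Lp.aestronglyMeasurable g
  have hm : ∀ (n : ℕ) (w : ℂ), AEStronglyMeasurable (fun x : ℝ => g x * ((((x - t : ℝ) : ℂ) + w)^n)⁻¹) volume := by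
    intro n w
    refine hgm.mul (Measurable.aestronglyMeasurable ?_)
    fun_prop
  have hbd : ∀ n : ℕ, 2 ≤ n → ∀ w ∈ Metric.ball w₀ ε, ∀ x : ℝ, (x < t → g x = 0) →
      ‖g x * ((((x - t : ℝ) : ℂ) + w)^n)⁻¹‖ ≤ (c^n)⁻¹ * (‖g x‖ * (1 + (x-t)^2)⁻¹) := by
    intro n hn w hwb x hx
    rcases lt_or_ge x t with h | h
    · simp [hx h]
    have hy : 0 ≤ x - t := sub_nonneg.2 h
    have h1 := hlow w hwb (x - t) hy
    have h2 : c^n * (1 + (x-t)^2) ≤ ‖(((x - t : ℝ) : ℂ) + w)^n‖ := by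
      rw [norm_pow]
      calc c^n * (1 + (x-t)^2) ≤ c^n * (1 + (x-t))^2 := by gcongr; nlinarith
        _ ≤ c^n * (1 + (x-t))^n := by gcongr; linarith
        _ = (c * (1 + (x-t)))^n := by rw [mul_pow]
        _ ≤ _ := by gcongr
    rw [norm_mul, norm_inv]
    calc _ ≤ ‖g x‖ * (c^n * (1 + (x-t)^2))⁻¹ := by gcongr
      _ = _ := by rw [mul_inv]; ring
  have hB := av_B_int g t
  have := hasDerivAt_integral_of_dominated_loc_of_deriv_le (μ := volume) (𝕜 := ℂ)
    (F := fun (w : ℂ) (x : ℝ) => g x * ((((x - t : ℝ) : ℂ) + w)^2)⁻¹)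
    (F' := fun (w : ℂ) (x : ℝ) => (-2) * (g x * ((((x - t : ℝ) : ℂ) + w)^3)⁻¹))
    (bound := fun x => 2 * ((c^3)⁻¹ * (‖g x‖ * (1 + (x-t)^2)⁻¹)))
    (x₀ := w₀) (s := Metric.ball w₀ ε) (Metric.ball_mem_nhds _ hε)
    (Eventually.of_forall fun w => hm 2 w) ?_ ((hm 3 w₀).const_mul _) ?_ ((hB.const_mul _).const_mul _) ?_
  · exact this.2.differentiableAt.differentiableWithinAt
  · refine (hB.const_mul (c^2)⁻¹).mono' (hm 2 w₀) ?_
    filter_upwards [hg] with x hx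
    exact hbd 2 le_rfl w₀ (Metric.mem_ball_self hε) x hx
  · filter_upwards [hg] with x hx w hwb
    rw [norm_mul]
    have := hbd 3 (by norm_num) w hwb x hx
    simp only [norm_neg, Complex.norm_ofNat]
    gcongr
  · filter_upwards [hg] with x hx w hwb
    rcases lt_or_ge x t with h | h
    · simp only [hx h, zero_mul, mul_zero]; exact hasDerivAt_const _ _
    have hy : 0 ≤ x - t := sub_nonneg.2 h
    have h1 := hlow w hwb (x - t) hy
    have hne : ((x - t : ℝ) : ℂ) + w ≠ 0 := by
      rw [← norm_pos_iff]; exact lt_of_lt_of_le (by positivity) h1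
    have hd := ((((hasDerivAt_id w).const_add ((x - t : ℝ) : ℂ)).pow 2).inv (pow_ne_zero 2 hne)).const_mul (g x)
    refine hd.congr_deriv ?_
    simp only [id, Pi.pow_apply]
    generalize ((x - t : ℝ) : ℂ) + w = z at hne
    field_simp
    norm_num
    ring

/-- Every proper subspace `e^{isx}H²(ℝ)` of the analytic nest meets every proper subspace
`L²([t,∞))` of the Volterra nest trivially. -/
theorem analytic_volterra_trivial_intersection (F : L2 →L[ℂ] L2)
    (hF : IsFourierPlancherel F) (s t : ℝ) (f : L2)
    (hfa : ∃ g ∈ H2 F, ⇑f =ᵐ[volume] fun x : ℝ => Complex.exp (Complex.I * s * x) * g x)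
    (hfv : ∀ᵐ x : ℝ ∂volume, x < t → f x = 0) :
    f = 0 := by
  obtain ⟨g, hgH, hfg⟩ := hfa
  have hgt : ∀ᵐ x : ℝ ∂volume, x < t → g x = 0 := by
    filter_upwards [hfv, hfg] with x h1 h2 hx
    have := h1 hx
    rw [h2] at this
    exact (mul_eq_zero.1 this).resolve_left (Complex.exp_ne_zero _)
  have hgH' : ∀ᵐ x : ℝ ∂volume, x < 0 → (F g) x = 0 := hgH
  suffices hg0 : g = 0 by
    rw [Lp.eq_zero_iff_ae_eq_zero]
    rw [Lp.eq_zero_iff_ae_eq_zero] at hg0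
    filter_upwards [hfg, hg0] with x h1 h2
    rw [h1, h2]; simp
  -- Step 1: the Cauchy-type transform vanishes on one side
  have step1 : ∀ p : ℂ, 0 < p.re → ∫ x : ℝ, g x * ((p - Complex.I * x)^2)⁻¹ = 0 := by
    intro p hp
    have hp' : 0 < ((starRingEnd ℂ) p).re := by simpa using hp
    have := (av_pair F hF g _ _ (av_K_int _ hp') (av_K_memLp _ hp') (av_K_fourier _ hp')).2
    have e : ∫ ξ, F g ξ * (starRingEnd ℂ) (2 * Real.pi * avV ((starRingEnd ℂ) p) (-ξ)) = 0 := by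
      rw [← integral_zero ℝ ℂ]
      refine integral_congr_ae ?_
      filter_upwards [hgH'] with ξ h
      rcases lt_or_ge ξ 0 with h0 | h0
      · simp [h h0]
      · rw [avV_neg _ (by linarith)]; simp
    rw [e, mul_zero] at this
    rw [← this]
    congr 1; ext x
    simp [sub_eq_add_neg]
  -- Step 2: analytic continuation across the gap
  have hCA := (av_diff g t hgt).analyticOnNhd isOpen_slitPlane
  have hIm : ∀ w : ℂ, 0 < w.im → ∫ x : ℝ, g x * ((((x - t : ℝ) : ℂ) + w)^2)⁻¹ = 0 := by
    intro w hw
    have h1 := step1 (-Complex.I * (w - t)) (by simpa using hw)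
    have e : ∀ x : ℝ, g x * ((((x - t : ℝ) : ℂ) + w)^2)⁻¹ =
        (-1) * (g x * ((-Complex.I * (w - t) - Complex.I * x)^2)⁻¹) := by
      intro x
      have : (-Complex.I * (w - t) - Complex.I * x)^2 = - (((x - t : ℝ) : ℂ) + w)^2 := by
        push_cast
        linear_combination ((x - t : ℂ) + w)^2 * Complex.I_sq
      rw [this, inv_neg]; ring
    simp_rw [e]
    rw [integral_const_mul, h1, mul_zero]
  have hzero := hCA.eqOn_zero_of_preconnected_of_eventuallyEq_zero
    (starConvex_one_slitPlane.isPathConnected (by simp [mem_slitPlane_iff])).isConnected.isPreconnected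
    (z₀ := Complex.I) (by simp [mem_slitPlane_iff]) (by
      filter_upwards [(isOpen_lt continuous_const Complex.continuous_im).mem_nhds
        (show (0:ℝ) < Complex.I.im by simp)] with w hw
      exact hIm w hw)
  have step2 : ∀ p : ℂ, 0 < p.re → ∫ x : ℝ, g x * ((p + Complex.I * x)^2)⁻¹ = 0 := by
    intro p hp
    have h1 := hzero (x := t - Complex.I * p) (by
      rw [mem_slitPlane_iff]; right; simpa using hp.ne')
    simp only [Pi.zero_apply] at h1
    have e : ∀ x : ℝ, g x * ((p + Complex.I * x)^2)⁻¹ =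
        (-1) * (g x * ((((x - t : ℝ) : ℂ) + (t - Complex.I * p))^2)⁻¹) := by
      intro x
      have : (p + Complex.I * x)^2 = - (((x - t : ℝ) : ℂ) + (t - Complex.I * p))^2 := by
        push_cast
        linear_combination (p^2 + x^2 : ℂ) * Complex.I_sq
      rw [this, inv_neg]; ring
    simp_rw [e]
    rw [integral_const_mul, h1, mul_zero]
  -- Step 3: Fourier side
  have step3 : ∀ p : ℂ, 0 < p.re → Integrable (fun ξ => F g ξ * avV p ξ) ∧
      ∫ ξ, F g ξ * avV p ξ = 0 := by
    intro p hp
    have hconj : ∀ x : ℝ, (starRingEnd ℂ) (((p + Complex.I * x)^2)⁻¹) =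
        (((starRingEnd ℂ) p + Complex.I * ((-x : ℝ) : ℂ))^2)⁻¹ := by
      intro x; simp
    have hp' : 0 < ((starRingEnd ℂ) p).re := by simpa using hp
    have hft : ∀ ξ : ℝ, ∫ x : ℝ, (starRingEnd ℂ) (((p + Complex.I * x)^2)⁻¹) *
        Complex.exp (-(Complex.I * x * ξ)) = 2 * Real.pi * avV ((starRingEnd ℂ) p) ξ := by
      intro ξ
      have h := av_K_fourier _ hp' (-ξ)
      rw [neg_neg] at h
      rw [← h, ← integral_neg_eq_self]
      congr 1; ext x
      rw [hconj]
      simp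
    have hki : Integrable (fun x : ℝ => (starRingEnd ℂ) (((p + Complex.I * x)^2)⁻¹)) := by
      simp_rw [hconj]
      exact (av_K_int _ hp').comp_neg
    have hk2 : MemLp (fun x : ℝ => (starRingEnd ℂ) (((p + Complex.I * x)^2)⁻¹)) 2 volume :=
      (av_K_memLp p hp).star
    obtain ⟨i1, i2⟩ := av_pair F hF g _ _ hki hk2 hft
    simp only [Complex.conj_conj] at i2
    rw [step2 p hp] at i2
    have e : ∀ ξ : ℝ, F g ξ * (starRingEnd ℂ) (2 * Real.pi * avV ((starRingEnd ℂ) p) ξ) =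
        (2 * Real.pi : ℂ) * (F g ξ * avV p ξ) := by
      intro ξ
      simp only [avV, map_mul, Complex.conj_ofReal, ← Complex.exp_conj, map_neg, Complex.conj_conj,
        map_ofNat]
      ring
    have hpi : (2 * Real.pi : ℂ) ≠ 0 := by
      have : (2 * Real.pi) ≠ 0 := by positivity
      exact_mod_cast this
    simp_rw [e] at i1 i2
    rw [integral_const_mul] at i2
    constructor
    · have := i1.const_mul (2 * Real.pi : ℂ)⁻¹
      simpa only [inv_mul_cancel_left₀ hpi] using this
    · have hs : ((Real.sqrt (2 * Real.pi) : ℂ))⁻¹ ≠ 0 := by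
        apply inv_ne_zero; exact_mod_cast (Real.sqrt_pos.2 (by positivity)).ne'
      exact ((mul_eq_zero.1 ((mul_eq_zero.1 i2.symm).resolve_left hs)).resolve_left hpi)
  have hae := av_fourier_inj (fun ξ => F g ξ * avV 1 ξ) (step3 1 (by simp)).1 (by
    intro w
    have h := (step3 (1 + Complex.I * w) (by simp)).2
    rw [← h]
    congr 1; ext ξ
    simp only [avV]
    have : -((1 + Complex.I * w) * (ξ:ℂ)) = -(Complex.I * w * ξ) + -(1 * (ξ:ℂ)) := by ring
    rw [this, Complex.exp_add]; ring)
  have hFg : F g = 0 := by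
    rw [Lp.eq_zero_iff_ae_eq_zero]
    have hn : ∀ᵐ x : ℝ ∂volume, x ≠ 0 := by simp [ae_iff]
    filter_upwards [hae, hgH', hn] with ξ h1 h2 h3
    rcases lt_or_gt_of_ne h3 with h | h
    · simpa using h2 h
    · refine (mul_eq_zero.1 h1).resolve_right ?_
      simp [avV, max_eq_left h.le, h.ne', Complex.exp_ne_zero]
  exact hF.1.injective (by rw [hFg, map_zero])
end
end

section
/- The Fourier binest algebra A_{FB} = Alg(N_a ∪ N_v), the algebra of bounded operators on L²(ℝ) leaving invariant every subspace e^{isx}H²(ℝ), s ∈ ℝ, and every subspace L²([t,∞)), t ∈ ℝ, satisfies A_{FB} ∩ A_{FB}* = ℂ·I. -/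
open MeasureTheory Complex Filter Set

noncomputable section

/-- Member `e^{isx}H²(ℝ)` of the analytic nest. -/
def Na (F : L2 →L[ℂ] L2) (s : ℝ) : Set L2 :=
  {f : L2 | ∃ g ∈ H2 F, ⇑f =ᵐ[volume] fun x : ℝ => Complex.exp (Complex.I * s * x) * g x}

/-- Member `L²([t,∞))` of the Volterra nest. -/
def Nv (t : ℝ) : Set L2 := {f : L2 | ∀ᵐ x : ℝ ∂volume, x < t → f x = 0}

/-- indicator of `[a,b)` as an element of `L²`. -/
def ind (a b : ℝ) : L2 :=
  indicatorConstLp 2 (measurableSet_Ico (a := a) (b := b)) (by simp) (1 : ℂ)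

lemma ind_coe (a b : ℝ) : ⇑(ind a b) =ᵐ[volume] (Set.Ico a b).indicator fun _ => (1 : ℂ) :=
  indicatorConstLp_coeFn

lemma ind_inner (a b : ℝ) (f : L2) : inner ℂ (ind a b) f = ∫ x in Set.Ico a b, f x :=
  L2.inner_indicatorConstLp_one _ _ _

lemma ind_zero {a b : ℝ} (h : b ≤ a) : ind a b = 0 := by
  apply Lp.ext
  filter_upwards [ind_coe a b, Lp.coeFn_zero ℂ 2 (volume : Measure ℝ)] with x h1 h2
  rw [h1, h2, Set.Ico_eq_empty (not_lt.2 h)]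
  simp

lemma ind_add {a b c : ℝ} (h : a ≤ b) (h' : b ≤ c) : ind a c = ind a b + ind b c := by
  apply Lp.ext
  filter_upwards [ind_coe a b, ind_coe b c, ind_coe a c, Lp.coeFn_add (ind a b) (ind b c)]
    with x h1 h2 h3 h4
  rw [h4, Pi.add_apply, h1, h2, h3]
  simp only [Set.indicator_apply, Set.mem_Ico]
  by_cases hb : x < b
  · have : ¬ b ≤ x := not_le.2 hb
    have : x < c := by linarith
    simp [*]
  · have : b ≤ x := not_lt.1 hb
    have : a ≤ x := by linarith
    simp [*]

lemma ind_norm_sq {a b : ℝ} (h : a ≤ b) : ‖ind a b‖ * ‖ind a b‖ = b - a := by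
  rw [ind, norm_indicatorConstLp (by norm_num) (by norm_num)]
  simp only [norm_one, one_mul, Real.volume_real_Ico_of_le h]
  rw [← Real.rpow_add_of_nonneg (by linarith) (by norm_num) (by norm_num)]
  norm_num

lemma eq_zero_of_ind (f : L2) (h : ∀ a b, a ≤ b → inner ℂ (ind a b) f = 0) : f = 0 := by
  have hf : LocallyIntegrable f volume := (Lp.memLp f).locallyIntegrable (by norm_num)
  apply Lp.ext
  filter_upwards [IsUnifLocDoublingMeasure.ae_tendsto_average volume hf 1,
    Lp.coeFn_zero ℂ 2 (volume : Measure ℝ)] with x hx h0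
  rw [h0]
  have := hx (l := nhdsWithin (0:ℝ) (Set.Ioi 0)) (fun _ => x) (fun j => j) tendsto_id (by
    filter_upwards [self_mem_nhdsWithin] with j hj
    simp only [Set.mem_Ioi] at hj
    simp [hj.le])
  refine tendsto_nhds_unique this (tendsto_const_nhds.congr' ?_)
  filter_upwards [self_mem_nhdsWithin] with j hj
  simp only [Set.mem_Ioi] at hj
  have h1 := h (x - j) (x + j) (by linarith)
  rw [ind_inner] at h1
  rw [setAverage_eq, Real.closedBall_eq_Icc, integral_Icc_eq_integral_Ico, h1]
  simp

lemma clm_zero (K : L2 →L[ℂ] L2) (h : ∀ a b, a ≤ b → K (ind a b) = 0) : K = 0 := by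
  have : ContinuousLinearMap.adjoint K = 0 := by
    ext1 g
    apply eq_zero_of_ind
    intro a b hab
    rw [ContinuousLinearMap.adjoint_inner_right, h a b hab, inner_zero_left]
  rw [← ContinuousLinearMap.adjoint_adjoint K, this, map_zero]

lemma clm_ext (K L : L2 →L[ℂ] L2) (h : ∀ a b, a ≤ b → K (ind a b) = L (ind a b)) : K = L := by
  rw [← sub_eq_zero]
  apply clm_zero
  intro a b hab
  simp [h a b hab]

/-- functions vanishing on `[t,∞)` -/
def Nl (t : ℝ) : Set L2 := {f : L2 | ∀ᵐ x : ℝ ∂volume, t ≤ x → f x = 0}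

lemma inner_nl_nv {t : ℝ} {f g : L2} (hf : f ∈ Nl t) (hg : g ∈ Nv t) : inner ℂ f g = 0 := by
  rw [L2.inner_def, integral_eq_zero_of_ae]
  filter_upwards [hf, hg] with x h1 h2
  rcases lt_or_ge x t with h | h
  · simp [h2 h]
  · simp [h1 h]

lemma inner_nv_nl {t : ℝ} {f g : L2} (hf : f ∈ Nv t) (hg : g ∈ Nl t) : inner ℂ f g = 0 := by
  rw [← inner_conj_symm, inner_nl_nv hg hf, map_zero]

lemma ind_nv {a b t : ℝ} (h : t ≤ a) : ind a b ∈ Nv t := by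
  filter_upwards [ind_coe a b] with x h1 h2
  rw [h1, Set.indicator_of_notMem]
  simp only [Set.mem_Ico, not_and, not_lt]
  intro h3; linarith

lemma ind_nl {a b t : ℝ} (h : b ≤ t) : ind a b ∈ Nl t := by
  filter_upwards [ind_coe a b] with x h1 h2
  rw [h1, Set.indicator_of_notMem]
  simp only [Set.mem_Ico, not_and, not_lt]
  intro h3; linarith

/-- operators commuting with cut-offs -/
def Loc (C : L2 →L[ℂ] L2) : Prop :=
  (∀ t, ∀ f ∈ Nv t, C f ∈ Nv t) ∧ (∀ t, ∀ f ∈ Nl t, C f ∈ Nl t)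

lemma loc_of_adj (X Y : L2 →L[ℂ] L2) (hX : ∀ t, ∀ f ∈ Nv t, X f ∈ Nv t)
    (hY : ∀ t, ∀ f ∈ Nv t, Y f ∈ Nv t) (h : ∀ f g, inner ℂ (Y g) f = inner ℂ g (X f)) :
    Loc X := by
  refine ⟨hX, fun t f hf => ?_⟩
  have hm : MemLp ((Set.Ici t).indicator (X f)) 2 volume :=
    (Lp.memLp (X f)).indicator measurableSet_Ici
  set g : L2 := hm.toLp _ with hg
  have hgc : ⇑g =ᵐ[volume] (Set.Ici t).indicator (X f) := hm.coeFn_toLp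
  have hgv : g ∈ Nv t := by
    filter_upwards [hgc] with x h1 h2
    rw [h1, Set.indicator_of_notMem]
    simpa using h2
  have h1 : inner ℂ g (X f) = 0 := by
    rw [← h]; exact inner_nv_nl (hY t g hgv) hf
  have h2 : inner ℂ g g = inner ℂ g (X f) := by
    rw [L2.inner_def, L2.inner_def]
    apply integral_congr_ae
    filter_upwards [hgc] with x hx
    simp only [hx, Set.indicator_apply]
    split_ifs <;> simp
  rw [h1, inner_self_eq_zero] at h2
  rw [h2] at hgc
  filter_upwards [hgc, Lp.coeFn_zero ℂ 2 (volume : Measure ℝ)] with x h3 h4 h5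
  rw [h4, Set.indicator_of_mem (by simpa using h5)] at h3
  simpa using h3.symm

lemma nv_sub {t : ℝ} {f g : L2} (hf : f ∈ Nv t) (hg : g ∈ Nv t) : f - g ∈ Nv t := by
  filter_upwards [hf, hg, Lp.coeFn_sub f g] with x h1 h2 h3 h4
  rw [h3, Pi.sub_apply, h1 h4, h2 h4, sub_zero]

lemma nl_sub {t : ℝ} {f g : L2} (hf : f ∈ Nl t) (hg : g ∈ Nl t) : f - g ∈ Nl t := by
  filter_upwards [hf, hg, Lp.coeFn_sub f g] with x h1 h2 h3 h4
  rw [h3, Pi.sub_apply, h1 h4, h2 h4, sub_zero]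

lemma Loc.sub {C D : L2 →L[ℂ] L2} (hC : Loc C) (hD : Loc D) : Loc (C - D) :=
  ⟨fun t f hf => nv_sub (hC.1 t f hf) (hD.1 t f hf),
    fun t f hf => nl_sub (hC.2 t f hf) (hD.2 t f hf)⟩

lemma Loc.comp {C D : L2 →L[ℂ] L2} (hC : Loc C) (hD : Loc D) : Loc (C ∘L D) :=
  ⟨fun t f hf => hC.1 t _ (hD.1 t f hf), fun t f hf => hC.2 t _ (hD.2 t f hf)⟩

lemma loc_const (c : ℂ) : Loc (c • ContinuousLinearMap.id ℂ L2) := by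
  constructor
  · intro t f hf
    filter_upwards [hf, Lp.coeFn_smul c f] with x h1 h2 h3
    simp [h2, h1 h3]
  · intro t f hf
    filter_upwards [hf, Lp.coeFn_smul c f] with x h1 h2 h3
    simp [h2, h1 h3]

lemma Loc.disj {C : L2 →L[ℂ] L2} (hC : Loc C) {a b c d : ℝ} (h : b ≤ c ∨ d ≤ a) :
    inner ℂ (ind a b) (C (ind c d)) = 0 := by
  rcases h with h | h
  · exact inner_nl_nv (ind_nl h) (hC.1 c _ (ind_nv le_rfl))
  · exact inner_nv_nl (ind_nv h) (hC.2 d _ (ind_nl le_rfl))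

lemma Loc.add {C : L2 →L[ℂ] L2} (hC : Loc C) {a b c : ℝ} (h : a ≤ b) (h' : b ≤ c) :
    inner ℂ (ind a c) (C (ind a c)) =
      inner ℂ (ind a b) (C (ind a b)) + inner ℂ (ind b c) (C (ind b c)) := by
  rw [ind_add h h', map_add, inner_add_left, inner_add_right, inner_add_right,
    hC.disj (Or.inl le_rfl), hC.disj (Or.inr le_rfl)]
  ring

lemma Loc.eq_zero {C : L2 →L[ℂ] L2} (hC : Loc C)
    (h : ∀ a b, a ≤ b → inner ℂ (ind a b) (C (ind a b)) = 0) : C = 0 := by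
  apply clm_zero
  intro c d hcd
  apply eq_zero_of_ind
  -- sub-intervals first
  have key : ∀ a b, c ≤ a → a ≤ b → b ≤ d → inner ℂ (ind a b) (C (ind c d)) = 0 := by
    intro a b h1 h2 h3
    rw [ind_add h1 (h2.trans h3), ind_add h2 h3, map_add, map_add, inner_add_right,
      inner_add_right, h a b h2, hC.disj (Or.inr le_rfl), hC.disj (Or.inl le_rfl)]
    simp
  intro a b hab
  rcases le_or_gt b c with hbc | hbc
  · exact hC.disj (Or.inl hbc)
  rcases le_or_gt d a with hda | hda
  · exact hC.disj (Or.inr hda)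
  have e1 : a ≤ max a c := le_max_left _ _
  have e2 : max a c ≤ min b d := by simp [hab, hbc.le, hda.le, hcd]
  have e3 : min b d ≤ b := min_le_left _ _
  rw [ind_add e1 (e2.trans e3), ind_add e2 e3, inner_add_left, inner_add_left,
    key _ _ (le_max_right _ _) e2 (min_le_right _ _)]
  have z1 : inner ℂ (ind a (max a c)) (C (ind c d)) = 0 := by
    rcases le_total a c with h1 | h1
    · rw [max_eq_right h1]; exact hC.disj (Or.inl le_rfl)
    · rw [max_eq_left h1, ind_zero le_rfl, inner_zero_left]
  have z2 : inner ℂ (ind (min b d) b) (C (ind c d)) = 0 := by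
    rcases le_total b d with h1 | h1
    · rw [min_eq_left h1, ind_zero le_rfl, inner_zero_left]
    · rw [min_eq_right h1]; exact hC.disj (Or.inr le_rfl)
  rw [z1, z2]; simp

lemma Loc.eq_zero_of_bound {C : L2 →L[ℂ] L2} (hC : Loc C) (K : ℝ)
    (h : ∀ a b, a ≤ b → ‖inner ℂ (ind a b) (C (ind a b))‖ ≤ K * (b - a) ^ 2) : C = 0 := by
  apply hC.eq_zero
  intro a b hab
  have step : ∀ δ : ℝ, 0 ≤ δ → ∀ k : ℕ,
      ‖inner ℂ (ind a (a + k * δ)) (C (ind a (a + k * δ)))‖ ≤ k * (K * δ ^ 2) := by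
    intro δ hδ k
    induction k with
    | zero => simp [ind_zero]
    | succ k ih =>
      have e : (0:ℝ) ≤ k * δ := by positivity
      push_cast
      rw [hC.add (b := a + k * δ) (by linarith) (by linarith)]
      refine (norm_add_le _ _).trans ?_
      have := h (a + k * δ) (a + (k + 1) * δ) (by linarith)
      rw [show a + (k + 1) * δ - (a + k * δ) = δ by ring] at this
      linarith
  have lim : Tendsto (fun n : ℕ => (K * (b - a) ^ 2) / (n : ℝ)) atTop (nhds 0) :=
    tendsto_const_div_atTop_nhds_zero_nat _
  rw [← norm_le_zero_iff]
  refine ge_of_tendsto lim ?_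
  filter_upwards [eventually_gt_atTop 0] with n hn
  have hn' : (0:ℝ) < n := by exact_mod_cast hn
  have := step ((b - a) / n) (div_nonneg (by linarith) hn'.le) n
  rw [mul_div_cancel₀ _ hn'.ne', show a + (b - a) = b by ring] at this
  refine this.trans (le_of_eq ?_)
  field_simp

/-- the character `e^{iax}` -/
def chi (a x : ℝ) : ℂ := Complex.exp (Complex.I * a * x)

lemma chi_norm (a x : ℝ) : ‖chi a x‖ = 1 := by
  rw [chi, show Complex.I * a * x = ((a * x : ℝ) : ℂ) * Complex.I by push_cast; ring]
  exact Complex.norm_exp_ofReal_mul_I _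

lemma chi_cont (a : ℝ) : Continuous (chi a) := by
  unfold chi; fun_prop

lemma chi_memLp (a : ℝ) (f : L2) : MemLp (fun x => chi a x * f x) 2 volume := by
  refine (Lp.memLp f).of_le ((chi_cont a).aestronglyMeasurable.mul (Lp.aestronglyMeasurable f)) ?_
  exact Eventually.of_forall fun x => by simp [chi_norm]

/-- multiplication by `e^{iax}` as a linear map -/
def mulLin (a : ℝ) : L2 →ₗ[ℂ] L2 where
  toFun f := (chi_memLp a f).toLp _
  map_add' f g := by
    apply Lp.ext
    filter_upwards [(chi_memLp a f).coeFn_toLp, (chi_memLp a g).coeFn_toLp,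
      (chi_memLp a (f + g)).coeFn_toLp, Lp.coeFn_add f g,
      Lp.coeFn_add ((chi_memLp a f).toLp _) ((chi_memLp a g).toLp _)] with x h1 h2 h3 h4 h5
    rw [h3, h5, Pi.add_apply, h1, h2, h4, Pi.add_apply]
    ring
  map_smul' c f := by
    apply Lp.ext
    filter_upwards [(chi_memLp a f).coeFn_toLp, (chi_memLp a (c • f)).coeFn_toLp,
      Lp.coeFn_smul c f, Lp.coeFn_smul c ((chi_memLp a f).toLp _)] with x h1 h2 h3 h4
    simp only [RingHom.id_apply]
    rw [h2, h4, Pi.smul_apply, h1, h3, Pi.smul_apply]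
    simp only [smul_eq_mul]
    ring

/-- multiplication by `e^{iax}` -/
def mulOp (a : ℝ) : L2 →L[ℂ] L2 :=
  (mulLin a).mkContinuous 1 fun f => by
    apply Lp.norm_le_mul_norm_of_ae_le_mul
    filter_upwards [(chi_memLp a f).coeFn_toLp] with x h1
    change ‖((chi_memLp a f).toLp _ : L2) x‖ ≤ _
    rw [h1]
    simp [chi_norm]

lemma mulOp_coe (a : ℝ) (f : L2) : ⇑(mulOp a f) =ᵐ[volume] fun x => chi a x * f x :=
  (chi_memLp a f).coeFn_toLp

lemma chi_conj (a x : ℝ) : (starRingEnd ℂ) (chi a x) = chi (-a) x := by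
  simp only [chi, ← Complex.exp_conj]
  simp

lemma mulOp_adj (a : ℝ) (f g : L2) : inner ℂ f (mulOp a g) = inner ℂ (mulOp (-a) f) g := by
  rw [L2.inner_def, L2.inner_def]
  apply integral_congr_ae
  filter_upwards [mulOp_coe a g, mulOp_coe (-a) f] with x h1 h2
  simp only [h1, h2, RCLike.inner_apply, map_mul, chi_conj, neg_neg]
  ring

lemma mulOp_inv (a : ℝ) (f : L2) : mulOp a (mulOp (-a) f) = f := by
  apply Lp.ext
  filter_upwards [mulOp_coe a (mulOp (-a) f), mulOp_coe (-a) f] with x h1 h2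
  rw [h1, h2, chi, chi, ← mul_assoc, ← Complex.exp_add]
  simp

lemma mulOp_loc (a : ℝ) : Loc (mulOp a) := by
  constructor
  · intro t f hf
    filter_upwards [hf, mulOp_coe a f] with x h1 h2 h3
    simp [h2, h1 h3]
  · intro t f hf
    filter_upwards [hf, mulOp_coe a f] with x h1 h2 h3
    simp [h2, h1 h3]

lemma chi_sub (a x y : ℝ) : ‖chi a x - chi a y‖ ≤ |a| * |x - y| := by
  have : chi a x - chi a y = chi a y * (Complex.exp (Complex.I * ((a * (x - y) : ℝ) : ℂ)) - 1) := by
    rw [mul_sub, chi, chi, ← Complex.exp_add]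
    push_cast
    ring_nf
  rw [this, norm_mul, chi_norm, one_mul, ← abs_mul]
  exact Real.norm_exp_I_mul_ofReal_sub_one_le

lemma mulOp_approx (a p q : ℝ) (h : p ≤ q) :
    ‖mulOp a (ind p q) - chi a p • ind p q‖ ≤ (|a| * (q - p)) * ‖ind p q‖ := by
  apply Lp.norm_le_mul_norm_of_ae_le_mul
  filter_upwards [mulOp_coe a (ind p q), Lp.coeFn_sub (mulOp a (ind p q)) (chi a p • ind p q),
    Lp.coeFn_smul (chi a p) (ind p q), ind_coe p q] with x h1 h2 h3 h4
  rw [h2, Pi.sub_apply, h1, h3, Pi.smul_apply, smul_eq_mul, ← sub_mul, norm_mul]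
  rw [h4]
  by_cases hx : x ∈ Set.Ico p q
  · rw [Set.indicator_of_mem hx]
    simp only [norm_one, mul_one]
    refine (chi_sub a x p).trans ?_
    gcongr
    rw [abs_of_nonneg (by linarith [hx.1])]
    linarith [hx.2]
  · rw [Set.indicator_of_notMem hx]
    simp

lemma mulOp_comm (B : L2 →L[ℂ] L2) (hB : Loc B) (a : ℝ) : B ∘L mulOp a = mulOp a ∘L B := by
  rw [← sub_eq_zero]
  apply ((hB.comp (mulOp_loc a)).sub ((mulOp_loc a).comp hB)).eq_zero_of_bound (2 * ‖B‖ * |a|)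
  intro p q hpq
  set e := ind p q with he
  have hee : ‖e‖ * ‖e‖ = q - p := ind_norm_sq hpq
  set r := mulOp a e - chi a p • e with hr
  set r' := mulOp (-a) e - chi (-a) p • e with hr'
  have b1 : ‖r‖ ≤ (|a| * (q - p)) * ‖e‖ := mulOp_approx a p q hpq
  have b2 : ‖r'‖ ≤ (|a| * (q - p)) * ‖e‖ := by
    simpa using mulOp_approx (-a) p q hpq
  have e1 : mulOp a e = r + chi a p • e := by rw [hr]; abel
  have e2 : mulOp (-a) e = r' + chi (-a) p • e := by rw [hr']; abel
  have : inner ℂ e ((B ∘L mulOp a - mulOp a ∘L B) e) = inner ℂ e (B r) - inner ℂ r' (B e) := by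
    simp only [_root_.sub_apply, ContinuousLinearMap.comp_apply, inner_sub_right]
    rw [mulOp_adj, e1, e2, map_add, map_smul, inner_add_right, inner_add_left, inner_smul_left,
      inner_smul_right, chi_conj, neg_neg]
    ring
  rw [this]
  have c1 : ‖inner ℂ e (B r)‖ ≤ ‖e‖ * (‖B‖ * ((|a| * (q - p)) * ‖e‖)) := by
    refine (norm_inner_le_norm _ _).trans ?_
    gcongr
    exact (B.le_opNorm r).trans (by gcongr)
  have c2 : ‖inner ℂ r' (B e)‖ ≤ ((|a| * (q - p)) * ‖e‖) * (‖B‖ * ‖e‖) := by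
    refine (norm_inner_le_norm _ _).trans ?_
    have : 0 ≤ q - p := by linarith
    gcongr
    exact B.le_opNorm e
  refine (norm_sub_le _ _).trans ((add_le_add c1 c2).trans (le_of_eq ?_))
  calc _ = 2 * ‖B‖ * |a| * (q - p) * (‖e‖ * ‖e‖) := by ring
    _ = _ := by rw [hee]; ring

lemma mp_sub (a : ℝ) : MeasurePreserving (fun x : ℝ => x - a) volume volume :=
  measurePreserving_sub_right volume a

/-- translation `f ↦ f(·-a)` -/
def shiftOp (a : ℝ) : L2 →ₗᵢ[ℂ] L2 := Lp.compMeasurePreservingₗᵢ ℂ (fun x : ℝ => x - a) (mp_sub a)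

lemma shiftOp_coe (a : ℝ) (f : L2) : ⇑(shiftOp a f) =ᵐ[volume] fun x => f (x - a) :=
  Lp.coeFn_compMeasurePreserving f (mp_sub a)

lemma ae_shift {p : ℝ → Prop} (a : ℝ) (h : ∀ᵐ x : ℝ, p x) : ∀ᵐ x : ℝ, p (x - a) :=
  (mp_sub a).quasiMeasurePreserving.ae h

lemma shiftOp_ind (a p q : ℝ) : shiftOp a (ind p q) = ind (p + a) (q + a) := by
  apply Lp.ext
  filter_upwards [shiftOp_coe a (ind p q), ae_shift a (ind_coe p q), ind_coe (p + a) (q + a)]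
    with x h1 h2 h3
  rw [h1, h2, h3]
  simp only [Set.indicator_apply, Set.mem_Ico, le_sub_iff_add_le, sub_lt_iff_lt_add]

lemma shiftOp_nv {a t : ℝ} {f : L2} (hf : f ∈ Nv t) : shiftOp a f ∈ Nv (t + a) := by
  filter_upwards [shiftOp_coe a f, ae_shift a hf] with x h1 h2 h3
  rw [h1, h2 (by linarith)]

lemma ind_integrable (p q : ℝ) : Integrable (ind p q) volume := by
  rw [integrable_congr (ind_coe p q), integrable_indicator_iff measurableSet_Ico]
  simp

lemma fourier_mul (F : L2 →L[ℂ] L2) (hF : IsFourierPlancherel F) (a : ℝ) (f : L2) :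
    F (mulOp a f) = shiftOp a (F f) := by
  have : F ∘L mulOp a = (shiftOp a).toContinuousLinearMap ∘L F := by
    apply clm_ext
    intro p q _
    change F (mulOp a (ind p q)) = shiftOp a (F (ind p q))
    have hi : Integrable (mulOp a (ind p q)) volume := by
      rw [integrable_congr (mulOp_coe _ _)]
      exact (ind_integrable p q).bdd_mul (c := 1) (chi_cont a).aestronglyMeasurable
        (Eventually.of_forall fun x => (chi_norm a x).le)
    apply Lp.ext
    filter_upwards [hF.2.2 _ hi, shiftOp_coe a (F (ind p q)),
      ae_shift a (hF.2.2 _ (ind_integrable p q))] with x h1 h2 h3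
    rw [h1, h2, h3]
    congr 1
    apply integral_congr_ae
    filter_upwards [mulOp_coe a (ind p q)] with t ht
    rw [ht, chi, mul_comm (Complex.exp _), mul_assoc, ← Complex.exp_add]
    congr 2
    push_cast
    ring
  exact congrArg (fun K : L2 →L[ℂ] L2 => K f) this

lemma fourier_shiftOp (F : L2 →L[ℂ] L2) (hF : IsFourierPlancherel F) (a : ℝ) (f : L2) :
    F (shiftOp a f) = mulOp (-a) (F f) := by
  have : F ∘L (shiftOp a).toContinuousLinearMap = mulOp (-a) ∘L F := by
    apply clm_ext
    intro p q _
    change F (shiftOp a (ind p q)) = mulOp (-a) (F (ind p q))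
    have hi : Integrable (shiftOp a (ind p q)) volume := by
      rw [shiftOp_ind]; exact ind_integrable _ _
    apply Lp.ext
    filter_upwards [hF.2.2 _ hi, mulOp_coe (-a) (F (ind p q)),
      hF.2.2 _ (ind_integrable p q)] with x h1 h2 h3
    rw [h1, h2, h3, mul_left_comm]
    congr 1
    rw [← integral_const_mul]
    refine Eq.trans ?_ (integral_sub_right_eq_self (fun t : ℝ => chi (-a) x * ((ind p q) t * Complex.exp (-(Complex.I * t * x)))) a)
    apply integral_congr_ae
    filter_upwards [shiftOp_coe a (ind p q)] with t ht
    rw [ht, chi, mul_left_comm, ← Complex.exp_add]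
    congr 2
    push_cast
    ring
  exact congrArg (fun K : L2 →L[ℂ] L2 => K f) this

lemma na_iff (F : L2 →L[ℂ] L2) (hF : IsFourierPlancherel F) (s : ℝ) (f : L2) :
    f ∈ Na F s ↔ F f ∈ Nv s := by
  constructor
  · rintro ⟨g, hg, h⟩
    have : f = mulOp s g := Lp.ext (h.trans (mulOp_coe s g).symm)
    have hg' : F g ∈ Nv 0 := hg
    rw [this, fourier_mul F hF]
    simpa using shiftOp_nv (a := s) hg'
  · intro h
    refine ⟨mulOp (-s) f, ?_, ?_⟩
    · have := shiftOp_nv (a := -s) h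
      rw [← fourier_mul F hF, add_neg_cancel] at this
      exact this
    · have := mulOp_coe s (mulOp (-s) f)
      rw [mulOp_inv] at this
      exact this

lemma additive_linear (φ : ℝ → ℂ) (M : ℝ) (hadd : ∀ s t, 0 ≤ s → 0 ≤ t → φ (s + t) = φ s + φ t)
    (hb : ∀ t, 0 ≤ t → ‖φ t‖ ≤ M * t) (t : ℝ) (ht : 0 ≤ t) : φ t = t * φ 1 := by
  have hmul : ∀ t, 0 ≤ t → ∀ n : ℕ, φ (n * t) = n * φ t := by
    intro t ht n
    induction n with
    | zero =>
      have := hb 0 le_rfl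
      simpa using this
    | succ n ih =>
      push_cast
      rw [add_mul, one_mul, hadd _ _ (by positivity) ht, ih]
      ring
  have hM : 0 ≤ M := by
    have := (norm_nonneg _).trans (hb 1 zero_le_one)
    simpa using this
  have key : ∀ n : ℕ, n * ‖φ t - t * φ 1‖ ≤ 2 * M := by
    intro n
    have h0 : (0:ℝ) ≤ n * t := by positivity
    set k := ⌊(n * t : ℝ)⌋₊ with hk
    have k1 : (k : ℝ) ≤ n * t := Nat.floor_le h0
    have k2 : (n * t : ℝ) < k + 1 := Nat.lt_floor_add_one _
    have e1 : φ (n * t) = φ (n * t - k) + k * φ 1 := by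
      have h1 := hadd (n * t - k) k (by linarith) (Nat.cast_nonneg k)
      have h2 := hmul 1 zero_le_one k
      rw [mul_one] at h2
      rw [← h2, ← h1]
      ring_nf
    have e2 : (n : ℂ) * (φ t - t * φ 1) = φ (n * t - k) - ((n * t - k : ℝ) : ℂ) * φ 1 := by
      have := hmul t ht n
      push_cast
      linear_combination e1 - this
    have e3 : n * ‖φ t - t * φ 1‖ = ‖(n : ℂ) * (φ t - t * φ 1)‖ := by simp
    rw [e3, e2]
    refine (norm_sub_le _ _).trans ?_
    have b1 := hb (n * t - k) (by linarith)
    have b2 := hb 1 zero_le_one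
    rw [norm_mul, Complex.norm_real, Real.norm_of_nonneg (by linarith)]
    have b3 : M * (n * t - k) ≤ M * 1 := by gcongr; linarith
    have b4 : (n * t - k : ℝ) * ‖φ 1‖ ≤ 1 * (M * 1) := by
      gcongr
      linarith
    linarith
  by_contra hne
  have hpos : 0 < ‖φ t - t * φ 1‖ := norm_pos_iff.2 (sub_ne_zero.2 hne)
  obtain ⟨n, hn⟩ := exists_nat_gt (2 * M / ‖φ t - t * φ 1‖)
  rw [div_lt_iff₀ hpos] at hn
  linarith [key n]

/-- The Fourier binest algebra `A_FB = Alg(N_a ∪ N_v)` satisfies `A_FB ∩ A_FB* = ℂ·I`. -/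
theorem fourier_binest_algebra_antisymmetric (F : L2 →L[ℂ] L2)
    (hF : IsFourierPlancherel F) (A : L2 →L[ℂ] L2)
    (hAa : ∀ s : ℝ, ∀ f ∈ Na F s, A f ∈ Na F s)
    (hAv : ∀ t : ℝ, ∀ f ∈ Nv t, A f ∈ Nv t)
    (hAsa : ∀ s : ℝ, ∀ f ∈ Na F s, (ContinuousLinearMap.adjoint A) f ∈ Na F s)
    (hAsv : ∀ t : ℝ, ∀ f ∈ Nv t, (ContinuousLinearMap.adjoint A) f ∈ Nv t) :
    ∃ c : ℂ, A = c • ContinuousLinearMap.id ℂ L2 := by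
  have hA : Loc A := loc_of_adj A (ContinuousLinearMap.adjoint A) hAv hAsv
    (fun f g => ContinuousLinearMap.adjoint_inner_left A f g)
  let E : L2 ≃ₗᵢ[ℂ] L2 := LinearIsometryEquiv.ofSurjective
    ⟨F.toLinearMap, fun x => (AddMonoidHomClass.isometry_iff_norm F).1 hF.1 x⟩ hF.2.1
  have hE : ∀ x, E x = F x := fun x => rfl
  let S : L2 →L[ℂ] L2 := (E.symm.toContinuousLinearEquiv : L2 →L[ℂ] L2)
  have hS : ∀ x, S x = E.symm x := fun x => rfl
  have hFS : ∀ x, F (S x) = x := fun x => E.apply_symm_apply x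
  have hSF : ∀ x, S (F x) = x := fun x => E.symm_apply_apply x
  have hB : Loc (F ∘L A ∘L S) := by
    apply loc_of_adj _ (F ∘L (ContinuousLinearMap.adjoint A) ∘L S)
    · intro t f hf
      exact (na_iff F hF t _).1 (hAa t _ ((na_iff F hF t _).2 (by have := hFS f; exact this.symm ▸ hf)))
    · intro t f hf
      exact (na_iff F hF t _).1 (hAsa t _ ((na_iff F hF t _).2 (by have := hFS f; exact this.symm ▸ hf)))
    · intro f g
      simp only [ContinuousLinearMap.comp_apply]
      rw [← hE, ← hE, LinearIsometryEquiv.inner_map_eq_flip, ← hS,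
        ContinuousLinearMap.adjoint_inner_left]
      have := LinearIsometryEquiv.inner_map_map E (S g) (A (S f))
      rw [← this, hE (S g), hFS]
  have hT : ∀ a f, A (shiftOp a f) = shiftOp a (A f) := by
    intro a f
    apply E.injective
    rw [hE, hE, fourier_shiftOp F hF]
    have := congrArg (fun K : L2 →L[ℂ] L2 => K (F f)) (mulOp_comm _ hB (-a))
    simp only [ContinuousLinearMap.comp_apply] at this
    rw [← fourier_shiftOp F hF, hSF, hSF] at this
    exact this
  let φ : ℝ → ℂ := fun t => inner ℂ (ind 0 t) (A (ind 0 t))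
  have hsh : ∀ a b, inner ℂ (ind a b) (A (ind a b)) = φ (b - a) := by
    intro a b
    have : ind a b = shiftOp a (ind 0 (b - a)) := by rw [shiftOp_ind]; simp
    rw [this, hT, LinearIsometry.inner_map_map]
  have hlin : ∀ t, 0 ≤ t → φ t = t * φ 1 := by
    apply additive_linear φ ‖A‖
    · intro s t hs ht
      have h1 : φ (s + t) = _ := hA.add (a := 0) (b := s) (c := s + t) hs (by linarith)
      rw [h1, hsh s (s + t)]
      simp [φ]
    · intro t ht
      refine (norm_inner_le_norm _ _).trans ?_
      have h1 := ind_norm_sq ht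
      have h2 := A.le_opNorm (ind 0 t)
      calc _ ≤ ‖ind 0 t‖ * (‖A‖ * ‖ind 0 t‖) := by gcongr
        _ = ‖A‖ * (‖ind 0 t‖ * ‖ind 0 t‖) := by ring
        _ = _ := by rw [h1, sub_zero]
  refine ⟨φ 1, ?_⟩
  rw [← sub_eq_zero]
  apply (hA.sub (loc_const (φ 1))).eq_zero
  intro a b hab
  simp only [_root_.sub_apply, _root_.smul_apply,
    ContinuousLinearMap.id_apply, inner_sub_right, inner_smul_right]
  rw [hsh, hlin _ (by linarith), inner_self_eq_norm_sq_to_K]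
  have h1 := ind_norm_sq hab
  rw [← h1]
  push_cast
  simp
  ring
end
end
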